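/- Let s be a weak composition and T ⪯ Z in s-weak order. Then the order complex Δ(T,Z) of the open interval (T,Z) is homotopy equivalent to a ball or a sphere of some dimension, and the Möbius function of s-weak order satisfies μ(T,Z) ∈ {−1, 0, 1}. -/

import Mathlib

open scoped Classical

/-- An `s`-decreasing tree with internal vertices `1,…,n` (the root is `n`), encoded by
recording, for each non-root internal vertex `v`, its parent `parent v` (an internal vertex
with a larger label, so that labels decrease away from the root) and the index `idx v` of
the child slot of `parent v` (among `0,…,s (parent v)`, left to right) containing `v`.
Distinct internal vertices occupy distinct child slots; all remaining slots are leaves. -/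
structure SDecTree (n : ℕ) (s : ℕ → ℕ) where
  parent : ℕ → ℕ
  idx : ℕ → ℕ
  parent_gt : ∀ v, 1 ≤ v → v < n → v < parent v
  parent_le : ∀ v, 1 ≤ v → v < n → parent v ≤ n
  idx_le : ∀ v, 1 ≤ v → v < n → idx v ≤ s (parent v)
  slot_inj : ∀ v w, 1 ≤ v → v < n → 1 ≤ w → w < n →
      parent v = parent w → idx v = idx w → v = w
  parent_out : ∀ v, v = 0 ∨ n ≤ v → parent v = 0
  idx_out : ∀ v, v = 0 ∨ n ≤ v → idx v = 0

namespace SDecTree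

variable {n : ℕ} {s : ℕ → ℕ}

/-- `y` is a weak ancestor of `x`, i.e. `x` is a labeled vertex of the subtree `T^y`. -/
def Descend (T : SDecTree n s) (x y : ℕ) : Prop :=
  ∃ k, T.parent^[k] x = y ∧ ∀ m ≤ k, 1 ≤ T.parent^[m] x ∧ T.parent^[m] x ≤ n

/-- `x` is a labeled vertex of the subtree `T^y_j` rooted at the `j`-th child of `y`. -/
def InSub (T : SDecTree n s) (y j x : ℕ) : Prop :=
  ∃ c, T.Descend x c ∧ T.parent c = y ∧ T.idx c = j

/-- `x` lies strictly left of `y` in the planar tree `T`. -/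
def LeftOf (T : SDecTree n s) (x y : ℕ) : Prop :=
  ∃ z j₁ j₂, j₁ < j₂ ∧ T.InSub z j₁ x ∧ T.InSub z j₂ y

/-- The cardinality `#_T(y,x)` of the pair `(y,x)`: it is `j` if `x ∈ T^y_j`
(so `0` if `x ∈ T^y_0` and `s y` if `x ∈ T^y_{s y}`), `0` if `x` is left of `y`, and
`s y` if `x` is right of `y`; it is `0` for out-of-range pairs. -/
noncomputable def card (T : SDecTree n s) (y x : ℕ) : ℕ :=
  if h : ∃ j, T.InSub y j x then h.choose
  else if 1 ≤ x ∧ x < y ∧ y ≤ n ∧ ¬ T.LeftOf x y then s y else 0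

/-- `x` is a labeled vertex of `T^a ∖ 0`, i.e. of `T^a` with `T^a_0` replaced by a leaf. -/
def InSubMinus0 (T : SDecTree n s) (a x : ℕ) : Prop :=
  x = a ∨ ∃ j, 0 < j ∧ T.InSub a j x

/-- `(a,b)` is a tree ascent of `T`. -/
def TreeAscent (T : SDecTree n s) (a b : ℕ) : Prop :=
  1 ≤ a ∧ a < b ∧ b ≤ n ∧
  (∃ i, i < s b ∧ T.InSub b i a) ∧
  (∀ e j, a < e → e < b → T.InSub e j a → j = s e) ∧
  (0 < s a → ∀ x, ¬ T.InSub a (s a) x)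

end SDecTree

/-- A multi-inversion set (encoded by its multiplicity function) is transitive:
if `a < b < c` then `#(b,a) = 0` or `#(c,a) ≥ #(c,b)`. -/
def IsTransitiveInv (I : ℕ → ℕ → ℕ) : Prop :=
  ∀ a b c, a < b → b < c → I b a = 0 ∨ I c b ≤ I c a

/-- The transitive closure of a multi-inversion set: the smallest (by inclusion, i.e.
pointwise on multiplicities) transitive multi-inversion set containing it. -/
noncomputable def tcInv (I : ℕ → ℕ → ℕ) : ℕ → ℕ → ℕ := fun y x =>
  sInf {m | ∃ J : ℕ → ℕ → ℕ, IsTransitiveInv J ∧ (∀ y' x', I y' x' ≤ J y' x') ∧ J y x = m}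

/-- Add one copy of the inversion `(b,a)` to `I`, capping the multiplicity at `s b`. -/
def addInv (s : ℕ → ℕ) (I : ℕ → ℕ → ℕ) (b a : ℕ) : ℕ → ℕ → ℕ := fun y x =>
  if y = b ∧ x = a then min (I y x + 1) (s y) else I y x

namespace SDecTree

variable {n : ℕ} {s : ℕ → ℕ}

/-- The `s`-weak order: `T ⪯ Z` iff `#_T(y,x) ≤ #_Z(y,x)` for all pairs. -/
def wle (T Z : SDecTree n s) : Prop := ∀ y x, T.card y x ≤ Z.card y x

/-- Strict `s`-weak order. -/
def wlt (T Z : SDecTree n s) : Prop := wle T Z ∧ ¬ wle Z T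

/-- Cover relation in the `s`-weak order. -/
def wcov (T Z : SDecTree n s) : Prop := wlt T Z ∧ ∀ U, wlt T U → wlt U Z → False

/-- `W` is the join of `T` and `Z` in the `s`-weak order. -/
def IsJoin (T Z W : SDecTree n s) : Prop :=
  wle T W ∧ wle Z W ∧ ∀ U, wle T U → wle Z U → wle W U

/-- `Z` is the `s`-tree rotation of `T` along the tree ascent `(a,b)`, i.e.
`inv Z = (inv T + (b,a))^tc`. -/
def IsRotation (T Z : SDecTree n s) (a b : ℕ) : Prop :=
  T.TreeAscent a b ∧
  ∀ y x, 1 ≤ x → x < y → y ≤ n → Z.card y x = tcInv (addInv s T.card b a) y x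

/-- The set `A_T(a,b)` of inversions added by a rotation producing `Z`: the pairs `(f,e)`
with `#_Z(f,e) > #_T(f,e)`. -/
def Aset (T Z : SDecTree n s) : Set (ℕ × ℕ) :=
  {p | T.card p.1 p.2 < Z.card p.1 p.2}

/-- The set `A_T(a,b)` described directly via the transitive closure. -/
def ARot (T : SDecTree n s) (a b : ℕ) : Set (ℕ × ℕ) :=
  {p | T.card p.1 p.2 < tcInv (addInv s T.card b a) p.1 p.2}

/-- The set `F_T(a,c)` (here `b` and `d` are the partners of `a` and `c` in the
respective tree ascents `(a,b)` and `(c,d)`): it is `{(d,e) : e ∈ T^a∖0}` if `b = c`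
and `a ∈ T^c_0`, and empty otherwise. -/
def Fset (T : SDecTree n s) (a b c d : ℕ) : Set (ℕ × ℕ) :=
  {p | b = c ∧ T.InSub c 0 a ∧ p.1 = d ∧ T.InSubMinus0 a p.2}

/-- `T` is an `s`-Tamari tree: `#_T(c,a) ≤ #_T(c,b)` whenever `a < b < c`. -/
def IsTamari (T : SDecTree n s) : Prop :=
  ∀ a b c, a < b → b < c → T.card c a ≤ T.card c b

/-- `(a,b)` is a Tamari tree ascent of `T`: `a` is a non-rightmost child of `b`. -/
def TamariAscent (T : SDecTree n s) (a b : ℕ) : Prop :=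
  1 ≤ a ∧ a < n ∧ T.parent a = b ∧ T.card b a < s b

/-- `Z` is the `s`-Tamari rotation of `T` along the Tamari tree ascent `(a,b)`. -/
def IsTamRotation (T Z : SDecTree n s) (a b : ℕ) : Prop :=
  T.TamariAscent a b ∧
  ∀ y x, 1 ≤ x → x < y → y ≤ n → Z.card y x = tcInv (addInv s T.card b a) y x

/-- Cover relation in the `s`-Tamari lattice. -/
def tamcov (T Z : SDecTree n s) : Prop :=
  IsTamari T ∧ IsTamari Z ∧ wlt T Z ∧ ∀ U, IsTamari U → wlt T U → wlt U Z → False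

/-- `W` is the join of `T` and `Z` in the `s`-Tamari lattice. -/
def IsTamJoin (T Z W : SDecTree n s) : Prop :=
  IsTamari W ∧ wle T W ∧ wle Z W ∧ ∀ U, IsTamari U → wle T U → wle Z U → wle W U

/-- The open interval `(T,Z)` in the `s`-weak order. -/
def OpenInterval (T Z : SDecTree n s) : Set (SDecTree n s) := {U | wlt T U ∧ wlt U Z}

/-- A set of trees forming a chain in the `s`-weak order. -/
def IsChainSet (C : Set (SDecTree n s)) : Prop :=
  C.Pairwise fun U V => wlt U V ∨ wlt V U

/-- The geometric realization of the order complex `Δ(T,Z)` of the open interval `(T,Z)`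
in the `s`-weak order: the space of finitely supported probability vectors on the vertex
set whose support is a chain of the open interval. -/
def orderComplex (T Z : SDecTree n s) : Set (SDecTree n s → ℝ) :=
  {f | (∀ U, 0 ≤ f U) ∧ (Function.support f).Finite ∧
    Function.support f ⊆ OpenInterval T Z ∧ IsChainSet (Function.support f) ∧
    ∑ᶠ U, f U = 1}

/-- The geometric realization of the order complex of the open interval `(T,Z)` in the
`s`-Tamari lattice. -/
def tamOrderComplex (T Z : SDecTree n s) : Set (SDecTree n s → ℝ) :=
  {f | (∀ U, 0 ≤ f U) ∧ (Function.support f).Finite ∧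
    Function.support f ⊆ {U | IsTamari U ∧ wlt T U ∧ wlt U Z} ∧
    IsChainSet (Function.support f) ∧ ∑ᶠ U, f U = 1}

end SDecTree

/-- The list of labels of the consecutive cover relations along a saturated chain,
recorded as a list of poset elements. -/
def labelsOf {α : Type*} (lab : α → α → ℕ) (L : List α) : List ℕ :=
  (L.zip L.tail).map fun p => lab p.1 p.2


namespace SDecTree

variable {n : ℕ} {s : ℕ → ℕ}

/-! ### Basic facts about descent in trees -/

theorem Descend.ranges {T : SDecTree n s} {x y : ℕ} (h : T.Descend x y) :
    (1 ≤ x ∧ x ≤ n) ∧ (1 ≤ y ∧ y ≤ n) := by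
  obtain ⟨k, hk, h⟩ := h
  refine ⟨by simpa using h 0 (Nat.zero_le _), ?_⟩
  have := h k le_rfl
  rwa [hk] at this

theorem desc_refl (T : SDecTree n s) {x : ℕ} (h1 : 1 ≤ x) (h2 : x ≤ n) : T.Descend x x :=
  ⟨0, rfl, fun m hm => by
    obtain rfl : m = 0 := by omega
    exact ⟨h1, h2⟩⟩

theorem parent_n (T : SDecTree n s) : T.parent n = 0 := T.parent_out n (Or.inr le_rfl)

theorem parent_lt_n (T : SDecTree n s) {x : ℕ} (h : 1 ≤ T.parent x) : 1 ≤ x ∧ x < n := by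
  by_contra hc
  have := T.parent_out x (by omega)
  omega

theorem desc_parent (T : SDecTree n s) {x : ℕ} (h1 : 1 ≤ x) (h2 : x < n) :
    T.Descend x (T.parent x) := by
  refine ⟨1, rfl, fun m hm => ?_⟩
  have ha := T.parent_gt x h1 h2
  have hb := T.parent_le x h1 h2
  obtain rfl | rfl : m = 0 ∨ m = 1 := by omega
  · simpa using ⟨h1, h2.le⟩
  · simp; omega

theorem desc_trans {T : SDecTree n s} {x y z : ℕ} (h : T.Descend x y) (h' : T.Descend y z) :
    T.Descend x z := by
  obtain ⟨k, hk, h⟩ := h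
  obtain ⟨l, hl, h'⟩ := h'
  refine ⟨l + k, by rw [Function.iterate_add_apply, hk, hl], fun m hm => ?_⟩
  by_cases hmk : m ≤ k
  · exact h m hmk
  · obtain ⟨r, rfl⟩ : ∃ r, m = r + k := ⟨m - k, by omega⟩
    rw [Function.iterate_add_apply, hk]
    exact h' r (by omega)

theorem desc_linear {T : SDecTree n s} {x y z : ℕ} (h : T.Descend x y) (h' : T.Descend x z) :
    T.Descend y z ∨ T.Descend z y := by
  obtain ⟨k, hk, h⟩ := h
  obtain ⟨l, hl, h'⟩ := h'
  rcases le_total k l with hkl | hkl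
  · left
    refine ⟨l - k, ?_, fun m hm => ?_⟩
    · rw [← hk, ← Function.iterate_add_apply, ← hl]; congr 2; omega
    · rw [← hk, ← Function.iterate_add_apply]; exact h' _ (by omega)
  · right
    refine ⟨k - l, ?_, fun m hm => ?_⟩
    · rw [← hl, ← Function.iterate_add_apply, ← hk]; congr 2; omega
    · rw [← hl, ← Function.iterate_add_apply]; exact h _ (by omega)

/-- first step of a nontrivial descent -/
theorem desc_head {T : SDecTree n s} {x y : ℕ} (h : T.Descend x y) (hne : x ≠ y) :
    1 ≤ x ∧ x < n ∧ T.Descend (T.parent x) y := by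
  obtain ⟨k, hk, h⟩ := h
  obtain _ | k := k
  · exact absurd hk hne
  · have h1 := h 1 (by omega)
    have := T.parent_lt_n (x := x) (by simpa using h1.1)
    refine ⟨this.1, this.2, k, by simpa using hk, fun m hm => ?_⟩
    exact h (m + 1) (by omega)

/-- last step of a nontrivial descent -/
theorem desc_last {T : SDecTree n s} {x y : ℕ} (h : T.Descend x y) (hne : x ≠ y) :
    ∃ c, T.Descend x c ∧ T.parent c = y ∧ 1 ≤ c ∧ c < n := by
  obtain ⟨k, hk, h⟩ := h
  obtain _ | k := k
  · exact absurd hk hne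
  · rw [Function.iterate_succ_apply'] at hk
    have hy := (h (k + 1) le_rfl).1
    rw [Function.iterate_succ_apply', hk] at hy
    have := T.parent_lt_n (x := T.parent^[k] x) (by omega)
    exact ⟨T.parent^[k] x, ⟨k, rfl, fun m hm => h m (by omega)⟩, hk, this.1, this.2⟩

theorem desc_le {T : SDecTree n s} {x y : ℕ} (h : T.Descend x y) : x ≤ y := by
  obtain ⟨k, hk, h⟩ := h
  induction k generalizing x with
  | zero => exact le_of_eq hk
  | succ k ih =>
    have h1 := h 1 (by omega)
    have h2 := T.parent_lt_n (x := x) (by simpa using h1.1)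
    have h3 := ih (x := T.parent x) (by simpa using hk) (fun m hm => h (m + 1) (by omega))
    have := T.parent_gt x h2.1 h2.2
    omega

theorem desc_root (T : SDecTree n s) {x : ℕ} (h1 : 1 ≤ x) (h2 : x ≤ n) : T.Descend x n := by
  induction hk : n - x using Nat.strong_induction_on generalizing x with
  | _ k ih =>
    by_cases hx : x = n
    · subst hx; exact T.desc_refl h1 h2
    · have ha := T.parent_gt x h1 (by omega)
      have hb := T.parent_le x h1 (by omega)
      exact desc_trans (T.desc_parent h1 (by omega)) (ih (n - T.parent x) (by omega) (by omega) hb rfl)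

/-! ### Facts about `InSub` and `LeftOf` -/

theorem InSub.range {T : SDecTree n s} {y j x : ℕ} (h : T.InSub y j x) : 1 ≤ x ∧ x ≤ n := by
  obtain ⟨c, hc, -⟩ := h
  exact hc.ranges.1

theorem InSub.spec {T : SDecTree n s} {y j x : ℕ} (h : T.InSub y j x) :
    (y = 0 ∧ j = 0) ∨ (x < y ∧ y ≤ n ∧ j ≤ s y ∧ T.Descend x y) := by
  obtain ⟨c, hc, rfl, rfl⟩ := h
  have hr := hc.ranges.2
  by_cases hcn : c = n
  · left; subst hcn; exact ⟨T.parent_n, T.idx_out _ (Or.inr le_rfl)⟩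
  · right
    have h1 := T.parent_gt c hr.1 (by omega)
    have := desc_le hc
    exact ⟨by omega, T.parent_le c hr.1 (by omega), T.idx_le c hr.1 (by omega),
      desc_trans hc (T.desc_parent hr.1 (by omega))⟩

theorem insub_of_desc {T : SDecTree n s} {x y : ℕ} (h : T.Descend x y) (hne : x ≠ y) :
    ∃ j, T.InSub y j x := by
  obtain ⟨c, h1, h2, -⟩ := desc_last h hne
  exact ⟨_, c, h1, h2, rfl⟩

theorem InSub.desc {T : SDecTree n s} {y j x x' : ℕ} (h : T.InSub y j x) (h' : T.Descend x' x) :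
    T.InSub y j x' := by
  obtain ⟨c, hc, h1, h2⟩ := h
  exact ⟨c, desc_trans h' hc, h1, h2⟩

theorem InSub.trans {T : SDecTree n s} {x y z i j : ℕ} (h : T.InSub y j x) (h' : T.InSub z i y) :
    T.InSub z i x := by
  have := h'.range
  rcases h.spec with h0 | h0
  · omega
  · exact h'.desc h0.2.2.2

theorem InSub.compare {T : SDecTree n s} {x z w i j : ℕ} (h : T.InSub z j x) (h' : T.InSub w i x) :
    (z = w ∧ j = i) ∨ T.InSub w i z ∨ T.InSub z j w := by
  obtain ⟨c, hc, h1, h2⟩ := h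
  obtain ⟨d, hd, h3, h4⟩ := h'
  by_cases hcd : c = d
  · subst hcd; left; exact ⟨h1.symm.trans h3, h2.symm.trans h4⟩
  · right
    rcases desc_linear hc hd with h | h
    · left
      exact ⟨d, by rw [← h1]; exact (desc_head h hcd).2.2, h3, h4⟩
    · right
      exact ⟨c, by rw [← h3]; exact (desc_head h (Ne.symm hcd)).2.2, h1, h2⟩

theorem InSub.irrefl {T : SDecTree n s} {x j : ℕ} : ¬ T.InSub x j x := by
  intro h
  have := h.range
  rcases h.spec with h | h <;> omega

theorem InSub.unique {T : SDecTree n s} {x z i j : ℕ} (h : T.InSub z j x) (h' : T.InSub z i x) :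
    j = i := by
  rcases h.compare h' with h | h | h
  · exact h.2
  · exact absurd h InSub.irrefl
  · exact absurd h InSub.irrefl

theorem LeftOf.desc_left {T : SDecTree n s} {x x' y : ℕ} (h : T.LeftOf x y) (h' : T.Descend x' x) :
    T.LeftOf x' y := by
  obtain ⟨z, j₁, j₂, hj, h1, h2⟩ := h
  exact ⟨z, j₁, j₂, hj, h1.desc h', h2⟩

theorem LeftOf.desc_right {T : SDecTree n s} {x y y' : ℕ} (h : T.LeftOf x y)
    (h' : T.Descend y' y) : T.LeftOf x y' := by
  obtain ⟨z, j₁, j₂, hj, h1, h2⟩ := h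
  exact ⟨z, j₁, j₂, hj, h1, h2.desc h'⟩

theorem LeftOf.trans {T : SDecTree n s} {a b c : ℕ} (h : T.LeftOf a b) (h' : T.LeftOf b c) :
    T.LeftOf a c := by
  obtain ⟨z, j₁, j₂, hj, h1, h2⟩ := h
  obtain ⟨w, i₁, i₂, hi, h3, h4⟩ := h'
  rcases h2.compare h3 with ⟨rfl, rfl⟩ | h | h
  · exact ⟨z, j₁, i₂, by omega, h1, h4⟩
  · exact ⟨w, i₁, i₂, hi, h1.trans h, h4⟩
  · exact ⟨z, j₁, j₂, hj, h1, h4.trans h⟩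

theorem LeftOf.irrefl {T : SDecTree n s} {a : ℕ} : ¬ T.LeftOf a a := by
  rintro ⟨z, j₁, j₂, hj, h1, h2⟩
  have := h1.unique h2
  omega

theorem left_above {T : SDecTree n s} {y j a b : ℕ} (h : T.InSub y j b) (h' : T.LeftOf b a) :
    (∃ j', j ≤ j' ∧ T.InSub y j' a) ∨ T.LeftOf y a := by
  obtain ⟨z, j₁, j₂, hj, h1, h2⟩ := h'
  rcases h.compare h1 with ⟨rfl, rfl⟩ | h | h
  · exact Or.inl ⟨j₂, hj.le, h2⟩
  · exact Or.inr ⟨z, j₁, j₂, hj, h, h2⟩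
  · exact Or.inl ⟨j, le_rfl, h2.trans h⟩

theorem right_above {T : SDecTree n s} {y j a b : ℕ} (h : T.InSub y j b) (h' : T.LeftOf a b) :
    (∃ j', j' ≤ j ∧ T.InSub y j' a) ∨ T.LeftOf a y := by
  obtain ⟨z, j₁, j₂, hj, h1, h2⟩ := h'
  rcases h.compare h2 with ⟨rfl, rfl⟩ | h | h
  · exact Or.inl ⟨j₁, hj.le, h1⟩
  · exact Or.inr ⟨z, j₁, j₂, hj, h1, h⟩
  · exact Or.inl ⟨j, le_rfl, h1.trans h⟩

theorem insub_not_left {T : SDecTree n s} {y j x : ℕ} (h : T.InSub y j x) (hy : 1 ≤ y) :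
    ¬ T.LeftOf x y ∧ ¬ T.LeftOf y x := by
  have hd : T.Descend x y := by
    rcases h.spec with h | h
    · omega
    · exact h.2.2.2
  exact ⟨fun h' => LeftOf.irrefl (h'.desc_right hd), fun h' => LeftOf.irrefl (h'.desc_left hd)⟩

theorem trichotomy (T : SDecTree n s) {x y : ℕ} (hx : 1 ≤ x) (hx' : x ≤ n) (hy : 1 ≤ y)
    (hy' : y ≤ n) : T.Descend x y ∨ T.Descend y x ∨ T.LeftOf x y ∨ T.LeftOf y x := by
  have hex : ∃ z, T.Descend x z ∧ T.Descend y z := ⟨n, T.desc_root hx hx', T.desc_root hy hy'⟩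
  have hz := Nat.find_spec hex
  have hmin := fun m => Nat.find_min hex (m := m)
  set z := Nat.find hex
  by_cases h1 : x = z
  · right; left; rw [h1]; exact hz.2
  by_cases h2 : y = z
  · left; rw [h2]; exact hz.1
  obtain ⟨c, hc1, hc2, hc3, hc4⟩ := desc_last hz.1 h1
  obtain ⟨d, hd1, hd2, hd3, hd4⟩ := desc_last hz.2 h2
  rcases lt_trichotomy (T.idx c) (T.idx d) with h | h | h
  · exact Or.inr (Or.inr (Or.inl ⟨z, _, _, h, ⟨c, hc1, hc2, rfl⟩, ⟨d, hd1, hd2, rfl⟩⟩))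
  · exfalso
    have := T.slot_inj c d hc3 hc4 hd3 hd4 (hc2.trans hd2.symm) h
    subst this
    have := T.parent_gt c hc3 hc4
    exact hmin c (by omega) ⟨hc1, hd1⟩
  · exact Or.inr (Or.inr (Or.inr ⟨z, _, _, h, ⟨d, hd1, hd2, rfl⟩, ⟨c, hc1, hc2, rfl⟩⟩))

theorem LeftOf.ranges {T : SDecTree n s} {x y : ℕ} (h : T.LeftOf x y) :
    (1 ≤ x ∧ x ≤ n) ∧ (1 ≤ y ∧ y ≤ n) := by
  obtain ⟨z, j₁, j₂, hj, h1, h2⟩ := h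
  exact ⟨h1.range, h2.range⟩

/-- trichotomy for a pair of labels `x < y` -/
theorem tri (T : SDecTree n s) {x y : ℕ} (hx : 1 ≤ x) (hxy : x < y) (hy : y ≤ n) :
    (∃ j, T.InSub y j x) ∨ T.LeftOf x y ∨ T.LeftOf y x := by
  rcases T.trichotomy hx (by omega) (by omega) hy with h | h | h | h
  · exact Or.inl (insub_of_desc h (by omega))
  · have := desc_le h; omega
  · exact Or.inr (Or.inl h)
  · exact Or.inr (Or.inr h)

/-! ### Values of `card` -/

theorem card_insub {T : SDecTree n s} {y j x : ℕ} (h : T.InSub y j x) : T.card y x = j := by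
  have hex : ∃ j, T.InSub y j x := ⟨j, h⟩
  rw [card, dif_pos hex]
  exact hex.choose_spec.unique h

theorem card_left {T : SDecTree n s} {y x : ℕ} (h : T.LeftOf x y) : T.card y x = 0 := by
  rw [card, dif_neg, if_neg]
  · tauto
  · rintro ⟨j, hj⟩
    exact (insub_not_left hj h.ranges.2.1).1 h

theorem card_right {T : SDecTree n s} {y x : ℕ} (h : T.LeftOf y x) (hxy : x < y) :
    T.card y x = s y := by
  rw [card, dif_neg, if_pos]
  · exact ⟨h.ranges.2.1, hxy, h.ranges.1.2, fun h' => LeftOf.irrefl (h.trans h')⟩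
  · rintro ⟨j, hj⟩
    exact (insub_not_left hj h.ranges.1.1).2 h

theorem card_out (T : SDecTree n s) {y x : ℕ} (h : ¬ (1 ≤ x ∧ x < y ∧ y ≤ n)) :
    T.card y x = 0 := by
  by_cases hex : ∃ j, T.InSub y j x
  · obtain ⟨j, hj⟩ := hex
    rw [card_insub hj]
    have := hj.range
    rcases hj.spec with h' | h' <;> omega
  · rw [card, dif_neg hex, if_neg]
    tauto

theorem card_le (T : SDecTree n s) (y x : ℕ) : T.card y x ≤ s y := by
  by_cases h : 1 ≤ x ∧ x < y ∧ y ≤ n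
  · rcases T.tri h.1 h.2.1 h.2.2 with ⟨j, hj⟩ | hl | hr
    · rw [card_insub hj]
      rcases hj.spec with h' | h' <;> omega
    · rw [card_left hl]; omega
    · rw [card_right hr h.2.1]
  · rw [T.card_out h]; omega

end SDecTree

/-- Valid multi-inversion sets. -/
structure ValidInv (n : ℕ) (s : ℕ → ℕ) (I : ℕ → ℕ → ℕ) : Prop where
  le : ∀ y x, I y x ≤ s y
  out : ∀ y x, ¬ (1 ≤ x ∧ x < y ∧ y ≤ n) → I y x = 0
  tr : ∀ a b c, 1 ≤ a → a < b → b < c → c ≤ n → I b a = 0 ∨ I c b ≤ I c a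
  pl : ∀ a b c, 1 ≤ a → a < b → b < c → c ≤ n → I b a = s b ∨ I c a ≤ I c b

namespace SDecTree

variable {n : ℕ} {s : ℕ → ℕ}

theorem card_valid (T : SDecTree n s) : ValidInv n s T.card where
  le := T.card_le
  out := fun y x h => T.card_out h
  tr := by
    intro a b c ha hab hbc hc
    rcases T.tri (by omega : 1 ≤ b) hbc hc with ⟨j, hj⟩ | hl | hr
    · rcases T.tri ha hab (by omega) with ⟨i, hi⟩ | hl' | hr'
      · right; rw [card_insub hj, card_insub (hi.trans hj)]
      · left; exact card_left hl'
      · right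
        rcases left_above hj hr' with ⟨j', h1, h2⟩ | h
        · rw [card_insub hj, card_insub h2]; exact h1
        · rw [card_right h (by omega)]; exact T.card_le _ _
    · right; rw [card_left hl]; omega
    · rcases T.tri ha hab (by omega) with ⟨i, hi⟩ | hl' | hr'
      · right
        have hd : T.Descend a b := by
          rcases hi.spec with h | h
          · omega
          · exact h.2.2.2
        rw [card_right (hr.desc_right hd) (by omega)]; exact T.card_le _ _
      · left; exact card_left hl'
      · right
        rw [card_right (hr.trans hr') (by omega)]; exact T.card_le _ _
  pl := by
    intro a b c ha hab hbc hc
    rcases T.tri (by omega : 1 ≤ b) hbc hc with ⟨j, hj⟩ | hl | hr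
    · rcases T.tri ha hab (by omega) with ⟨i, hi⟩ | hl' | hr'
      · right; rw [card_insub hj, card_insub (hi.trans hj)]
      · right
        rcases right_above hj hl' with ⟨j', h1, h2⟩ | h
        · rw [card_insub hj, card_insub h2]; exact h1
        · rw [card_left h]; omega
      · left; exact card_right hr' hab
    · rcases T.tri ha hab (by omega) with ⟨i, hi⟩ | hl' | hr'
      · right
        have hd : T.Descend a b := by
          rcases hi.spec with h | h
          · omega
          · exact h.2.2.2
        rw [card_left (hl.desc_left hd)]; omega
      · right
        rw [card_left (hl'.trans hl)]; omega
      · left; exact card_right hr' hab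
    · right; rw [card_right hr hbc]; exact T.card_le _ _

/-! ### The tree is determined by its cardinalities -/

theorem desc_iff (T : SDecTree n s) {x y : ℕ} (hx : 1 ≤ x) (hxy : x ≤ y) (hy : y ≤ n) :
    T.Descend x y ↔ ∀ c, y < c → c ≤ n → T.card c x = T.card c y := by
  constructor
  · intro h c hc hcn
    rcases T.tri (by omega : 1 ≤ y) hc hcn with ⟨j, hj⟩ | hl | hr
    · rw [card_insub hj, card_insub (hj.desc h)]
    · rw [card_left hl, card_left (hl.desc_left h)]
    · rw [card_right hr hc, card_right (hr.desc_right h) (by omega)]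
  · intro h
    have key : ∀ z j₁ j₂, j₁ ≠ j₂ → T.InSub z j₁ x → T.InSub z j₂ y → False := by
      intro z j₁ j₂ hj h1 h2
      rcases h1.spec with h' | h'
      · rcases h2.spec with h'' | h'' <;> omega
      · rcases h2.spec with h'' | h''
        · omega
        · have := h z h''.1 h''.2.1
          rw [card_insub h1, card_insub h2] at this
          exact hj this
    rcases T.trichotomy hx (by omega) (by omega) hy with h | h' | ⟨z, j₁, j₂, hj, h1, h2⟩ |
      ⟨z, j₁, j₂, hj, h1, h2⟩
    · exact h
    · have := desc_le h'
      obtain rfl : x = y := by omega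
      exact h'
    · exact (key z _ _ (by omega) h1 h2).elim
    · exact (key z _ _ (by omega) h2 h1).elim

theorem card_inj {T U : SDecTree n s} (h : T.card = U.card) : T = U := by
  have hd : ∀ x y, T.Descend x y → U.Descend x y := by
    intro x y hxy
    have h1 := hxy.ranges
    have h2 := desc_le hxy
    rw [U.desc_iff h1.1.1 h2 h1.2.2, ← h, ← T.desc_iff h1.1.1 h2 h1.2.2]
    exact hxy
  have hd' : ∀ x y, U.Descend x y → T.Descend x y := by
    intro x y hxy
    have h1 := hxy.ranges
    have h2 := desc_le hxy
    rw [T.desc_iff h1.1.1 h2 h1.2.2, h, ← U.desc_iff h1.1.1 h2 h1.2.2]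
    exact hxy
  have hp : ∀ v, T.parent v = U.parent v := by
    intro v
    by_cases hv : v = 0 ∨ n ≤ v
    · rw [T.parent_out v hv, U.parent_out v hv]
    · have hv1 : 1 ≤ v := by omega
      have hv2 : v < n := by omega
      have a1 := T.parent_gt v hv1 hv2
      have a2 := U.parent_gt v hv1 hv2
      have b1 := desc_le (desc_head (hd _ _ (T.desc_parent hv1 hv2)) (by omega)).2.2
      have b2 := desc_le (desc_head (hd' _ _ (U.desc_parent hv1 hv2)) (by omega)).2.2
      omega
  have hi : ∀ v, T.idx v = U.idx v := by
    intro v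
    by_cases hv : v = 0 ∨ n ≤ v
    · rw [T.idx_out v hv, U.idx_out v hv]
    · have hv1 : 1 ≤ v := by omega
      have hv2 : v < n := by omega
      have e1 : T.card (T.parent v) v = T.idx v :=
        card_insub ⟨v, T.desc_refl hv1 hv2.le, rfl, rfl⟩
      have e2 : U.card (U.parent v) v = U.idx v :=
        card_insub ⟨v, U.desc_refl hv1 hv2.le, rfl, rfl⟩
      rw [← e1, ← e2, h, hp]
  cases T; cases U
  simp only [mk.injEq]
  exact ⟨funext hp, funext hi⟩

/-! ### Constructing a tree from a valid multi-inversion set -/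

/-- The ancestor relation read off a multi-inversion set. -/
def Anc (n : ℕ) (I : ℕ → ℕ → ℕ) (x y : ℕ) : Prop :=
  x ≤ y ∧ ∀ c, y < c → c ≤ n → I c x = I c y

theorem anc_exists (I : ℕ → ℕ → ℕ) {v : ℕ} (hv : v < n) : ∃ y, v < y ∧ y ≤ n ∧ Anc n I v y :=
  ⟨n, hv, le_rfl, hv.le, fun c h1 h2 => by omega⟩

/-- The parent function read off a multi-inversion set. -/
noncomputable def par (n : ℕ) (I : ℕ → ℕ → ℕ) (v : ℕ) : ℕ :=
  if h : 1 ≤ v ∧ v < n then Nat.find (anc_exists I h.2) else 0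

theorem par_spec (I : ℕ → ℕ → ℕ) {v : ℕ} (h : 1 ≤ v) (h' : v < n) :
    v < par n I v ∧ par n I v ≤ n ∧ Anc n I v (par n I v) := by
  rw [par, dif_pos ⟨h, h'⟩]
  exact Nat.find_spec (anc_exists I h')

theorem par_min (I : ℕ → ℕ → ℕ) {v y : ℕ} (h : 1 ≤ v) (h' : v < y) (hy : y ≤ n)
    (hA : Anc n I v y) : par n I v ≤ y := by
  rw [par, dif_pos ⟨h, by omega⟩]
  exact Nat.find_min' (anc_exists I (by omega)) ⟨h', hy, hA⟩

theorem slot_aux {I : ℕ → ℕ → ℕ} (hI : ValidInv n s I) {v w : ℕ} (hv : 1 ≤ v) (hvw : v < w)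
    (hw : w < n) (hp : par n I v = par n I w) (hi : I (par n I v) v = I (par n I w) w) :
    False := by
  obtain ⟨a1, a2, a3⟩ := par_spec I hv (hvw.trans hw)
  obtain ⟨b1, b2, b3⟩ := par_spec I (by omega : 1 ≤ w) hw
  have key : ∀ k c, n - c = k → w < c → c ≤ n → I c v = I c w := by
    intro k
    induction k using Nat.strong_induction_on with
    | _ k ih =>
      intro c hk hwc hcn
      rcases lt_trichotomy c (par n I w) with h | h | h
      · have hna : ¬ Anc n I w c := fun hA => by
          have := par_min I (by omega : 1 ≤ w) hwc hcn hA
          omega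
        obtain ⟨d, hd1, hd2, hd3⟩ : ∃ d, c < d ∧ d ≤ n ∧ I d w ≠ I d c := by
          by_contra hcon
          push Not at hcon
          exact hna ⟨hwc.le, hcon⟩
        have e := ih (n - d) (by omega) d rfl (by omega) hd2
        rcases lt_or_gt_of_ne hd3 with h' | h'
        · have t1 := hI.tr w c d (by omega) hwc hd1 hd2
          have t2 := hI.tr v c d hv (by omega) hd1 hd2
          omega
        · have t1 := hI.pl w c d (by omega) hwc hd1 hd2
          have t2 := hI.pl v c d hv (by omega) hd1 hd2
          omega
      · rw [h]; rw [hp] at hi; exact hi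
      · rw [b3.2 c h hcn, a3.2 c (by omega) hcn, hp]
  have := par_min I hv hvw hw.le ⟨hvw.le, fun c h1 h2 => key _ c rfl h1 h2⟩
  omega

/-- The tree of a valid multi-inversion set. -/
noncomputable def ofInv {I : ℕ → ℕ → ℕ} (hI : ValidInv n s I) : SDecTree n s where
  parent := par n I
  idx := fun v => I (par n I v) v
  parent_gt := fun v h h' => (par_spec I h h').1
  parent_le := fun v h h' => (par_spec I h h').2.1
  idx_le := fun v _ _ => hI.le _ _
  slot_inj := by
    intro v w hv hv' hw hw' hp hi
    by_contra hne
    rcases lt_or_gt_of_ne hne with h | h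
    · exact slot_aux hI hv h hw' hp hi
    · exact slot_aux hI hw h hv' hp.symm hi.symm
  parent_out := fun v h => by
    rw [par, dif_neg]; omega
  idx_out := fun v h => by
    apply hI.out
    have : par n I v = 0 := by rw [par, dif_neg]; omega
    omega

theorem desc_ofInv {I : ℕ → ℕ → ℕ} (hI : ValidInv n s I) {x y : ℕ} (h1 : 1 ≤ x) (hy : y ≤ n) :
    (ofInv hI).Descend x y ↔ Anc n I x y := by
  constructor
  · rintro ⟨k, hk, h⟩
    induction k generalizing x with
    | zero =>
      obtain rfl : x = y := hk
      exact ⟨le_rfl, fun _ _ _ => rfl⟩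
    | succ k ih =>
      have h2 := h 1 (by omega)
      have h3 := (ofInv hI).parent_lt_n (x := x) (by simpa using h2.1)
      obtain ⟨p1, p2, p3⟩ := par_spec I h3.1 h3.2
      have h4 := ih (x := par n I x) (by omega) hk
        (fun m hm => h (m + 1) (by omega))
      refine ⟨by have := h4.1; omega, fun c hc hcn => ?_⟩
      have := h4.1
      rw [p3.2 c (by omega) hcn, h4.2 c hc hcn]
  · intro h
    induction hk : y - x using Nat.strong_induction_on generalizing x with
    | _ k ih =>
      have hxy := h.1
      by_cases he : x = y
      · subst he; exact desc_refl _ h1 hy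
      · obtain ⟨p1, p2, p3⟩ := par_spec I h1 (by omega : x < n)
        have p4 := par_min I h1 (by omega) hy h
        refine desc_trans ((ofInv hI).desc_parent h1 (by omega)) ?_
        refine ih (y - par n I x) (by omega) (x := par n I x) (by omega) ⟨p4, fun c hc hcn => ?_⟩ rfl
        rw [← h.2 c hc hcn, p3.2 c (by omega) hcn]

theorem insub_ofInv {I : ℕ → ℕ → ℕ} (hI : ValidInv n s I) {x y j : ℕ}
    (h : (ofInv hI).InSub y j x) (hy : 1 ≤ y) : I y x = j := by
  obtain ⟨c, hc, h1, h2⟩ := h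
  have hr := hc.ranges
  have h3 := (ofInv hI).parent_lt_n (x := c) (by omega)
  have h4 := (ofInv hI).parent_gt c h3.1 h3.2
  have h5 := (ofInv hI).parent_le c h3.1 h3.2
  rw [desc_ofInv hI hr.1.1 hr.2.2] at hc
  rw [hc.2 y (by omega) (by omega), ← h2, ← h1]
  rfl

theorem card_ofInv {I : ℕ → ℕ → ℕ} (hI : ValidInv n s I) : (ofInv hI).card = I := by
  funext y x
  by_cases h : 1 ≤ x ∧ x < y ∧ y ≤ n
  · obtain ⟨h1, h2, h3⟩ := h
    have key : ∀ u v, (ofInv hI).LeftOf u v → ∃ z, 1 ≤ z ∧ z ≤ n ∧ v < z ∧ u < z ∧ I z u < I z v := by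
      rintro u v ⟨z, j₁, j₂, hj, i1, i2⟩
      have hz : 1 ≤ z := by
        rcases i1.spec with h' | h'
        · rcases i2.spec with h'' | h'' <;> omega
        · omega
      refine ⟨z, hz, ?_, ?_, ?_, ?_⟩
      · rcases i1.spec with h' | h' <;> omega
      · rcases i2.spec with h' | h' <;> omega
      · rcases i1.spec with h' | h' <;> omega
      · rw [insub_ofInv hI i1 hz, insub_ofInv hI i2 hz]; exact hj
    rcases (ofInv hI).tri h1 h2 h3 with ⟨j, hj⟩ | hl | hr
    · rw [card_insub hj, insub_ofInv hI hj (by omega)]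
    · rw [card_left hl]
      obtain ⟨z, z1, z2, z3, z4, z5⟩ := key _ _ hl
      have := hI.tr x y z h1 h2 z3 z2
      omega
    · rw [card_right hr h2]
      obtain ⟨z, z1, z2, z3, z4, z5⟩ := key _ _ hr
      have := hI.pl x y z h1 h2 z4 z2
      omega
  · rw [(ofInv hI).card_out h, hI.out _ _ h]

end SDecTree


/-! ### Joins and meets of valid multi-inversion sets -/

namespace InvLat

variable {n : ℕ} {s : ℕ → ℕ}

/-- A step of a path used in the transitive closure. -/
def Step (M : ℕ → ℕ → ℕ) (x y : ℕ) : Prop := 1 ≤ y ∧ y < x ∧ 0 < M x y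

/-- Reachability by steps. -/
def Reach (M : ℕ → ℕ → ℕ) : ℕ → ℕ → Prop := Relation.ReflTransGen (Step M)

theorem Reach.le {M : ℕ → ℕ → ℕ} {x y : ℕ} (h : Reach M x y) : y ≤ x := by
  induction h with
  | refl => exact le_rfl
  | tail _ h ih => have := h.2.1; omega

/-- The explicit transitive closure. -/
noncomputable def tc (n : ℕ) (M : ℕ → ℕ → ℕ) (c a : ℕ) : ℕ :=
  if 1 ≤ a ∧ a < c ∧ c ≤ n then
    ((Finset.range c).filter (fun d => Reach M d a)).sup (fun d => M c d)
  else 0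

theorem tc_ge {M : ℕ → ℕ → ℕ} {c d a : ℕ} (ha : 1 ≤ a) (hd : d < c) (hc : c ≤ n)
    (h : Reach M d a) : M c d ≤ tc n M c a := by
  have := h.le
  rw [tc, if_pos ⟨ha, by omega, hc⟩]
  exact Finset.le_sup (f := fun d => M c d) (by simp [hd, h])

theorem tc_le {M : ℕ → ℕ → ℕ} {c a m : ℕ} (h : ∀ d, d < c → Reach M d a → M c d ≤ m) :
    tc n M c a ≤ m := by
  rw [tc]
  split_ifs with h1
  · apply Finset.sup_le
    intro d hd
    simp only [Finset.mem_filter, Finset.mem_range] at hd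
    exact h d hd.1 hd.2
  · omega

theorem tc_attained {M : ℕ → ℕ → ℕ} {c a : ℕ} (h : 0 < tc n M c a) :
    ∃ d, d < c ∧ Reach M d a ∧ M c d = tc n M c a := by
  by_contra hcon
  push Not at hcon
  have : tc n M c a ≤ tc n M c a - 1 := tc_le fun d hd hr => by
    have h1 := hcon d hd hr
    by_cases hr' : 1 ≤ a ∧ a < c ∧ c ≤ n
    · have := tc_ge (n := n) hr'.1 hd hr'.2.2 hr
      omega
    · rw [tc, if_neg hr'] at h; omega
  omega

theorem le_tc {M : ℕ → ℕ → ℕ} (hout : ∀ y x, ¬ (1 ≤ x ∧ x < y ∧ y ≤ n) → M y x = 0) (y x : ℕ) :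
    M y x ≤ tc n M y x := by
  by_cases h : 1 ≤ x ∧ x < y ∧ y ≤ n
  · exact tc_ge h.1 h.2.1 h.2.2 Relation.ReflTransGen.refl
  · rw [hout _ _ h]; omega

theorem tc_tr {M : ℕ → ℕ → ℕ} {a b c : ℕ} (ha : 1 ≤ a) (hab : a < b) (_hbc : b < c)
    (hc : c ≤ n) (hpos : 0 < tc n M b a) : tc n M c b ≤ tc n M c a := by
  obtain ⟨d, hd, hr, he⟩ := tc_attained hpos
  have hda := hr.le
  have hba : Reach M b a := Relation.ReflTransGen.head ⟨by omega, hd, by omega⟩ hr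
  exact tc_le fun e he hr' => tc_ge ha he hc (hr'.trans hba)

/-- crossing lemma: a path from `d` to `a` with `a < b < d` -/
theorem cross {M : ℕ → ℕ → ℕ}
    (hpl : ∀ a b c, 1 ≤ a → a < b → b < c → c ≤ n → M b a = s b ∨ M c a ≤ M c b)
    {a b d : ℕ} (h : Reach M d a) (hab : a < b) (hbd : b < d) (hd : d ≤ n) :
    Reach M d b ∨ ∃ e, Reach M e a ∧ 1 ≤ e ∧ e < b ∧ M b e = s b := by
  induction h using Relation.ReflTransGen.head_induction_on with
  | refl => omega
  | head hst htl ih =>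
    rename_i x y
    rcases lt_trichotomy b y with h | h | h
    · have := hst.2.1
      rcases ih h (by omega) with h' | h'
      · exact Or.inl (Relation.ReflTransGen.head hst h')
      · exact Or.inr h'
    · subst h; exact Or.inl (Relation.ReflTransGen.single hst)
    · rcases hpl y b x hst.1 h hbd hd with h' | h'
      · exact Or.inr ⟨y, htl, hst.1, h, h'⟩
      · refine Or.inl (Relation.ReflTransGen.single ⟨by omega, hbd, ?_⟩)
        have := hst.2.2; omega

theorem tc_valid {M : ℕ → ℕ → ℕ} (hle : ∀ y x, M y x ≤ s y)
    (hpl : ∀ a b c, 1 ≤ a → a < b → b < c → c ≤ n → M b a = s b ∨ M c a ≤ M c b) :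
    ValidInv n s (tc n M) where
  le := fun y x => tc_le fun d _ _ => hle _ _
  out := fun y x h => by rw [tc, if_neg h]
  tr := by
    intro a b c ha hab hbc hc
    by_cases h : tc n M b a = 0
    · exact Or.inl h
    · exact Or.inr (tc_tr ha hab hbc hc (by omega))
  pl := by
    intro a b c ha hab hbc hc
    by_contra hcon
    push Not at hcon
    obtain ⟨hne, hlt⟩ := hcon
    have hle' : tc n M b a ≤ s b := tc_le fun d _ _ => hle _ _
    obtain ⟨d, hd, hr, he⟩ := tc_attained (n := n) (M := M) (c := c) (a := a) (by omega)
    have key : ∀ e, Reach M e a → 1 ≤ e → e < b → M b e = s b → False := by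
      intro e h1 h2 h3 h4
      have := tc_ge (n := n) ha h3 (by omega) h1
      omega
    rcases lt_trichotomy d b with h | h | h
    · have := hr.le
      rcases hpl d b c (by omega) h hbc hc with h' | h'
      · exact key d hr (by omega) h h'
      · have := tc_ge (n := n) (M := M) (c := c) (d := b) (a := b) (by omega) hbc hc
          Relation.ReflTransGen.refl
        omega
    · subst h
      have := tc_ge (n := n) (M := M) (c := c) (d := d) (a := d) (by omega) hbc hc
        Relation.ReflTransGen.refl
      omega
    · rcases cross hpl hr hab h (by omega) with h' | ⟨e, h1, h2, h3, h4⟩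
      · have := tc_ge (n := n) (by omega) hd hc h'
        omega
      · exact key e h1 h2 h3 h4

theorem tc_least {M J : ℕ → ℕ → ℕ} (hJ : ValidInv n s J) (hMJ : ∀ y x, M y x ≤ J y x) (y x : ℕ) :
    tc n M y x ≤ J y x := by
  by_cases hr : 1 ≤ x ∧ x < y ∧ y ≤ n
  · refine tc_le fun d hd h => (hMJ y d).trans ?_
    induction h using Relation.ReflTransGen.head_induction_on with
    | refl => exact le_rfl
    | head hst htl ih =>
      rename_i u v
      have h1 := hst.2.1
      refine le_trans ?_ (ih (by omega))
      have := hJ.tr v u y hst.1 hst.2.1 hd hr.2.2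
      have h2 := hst.2.2
      have h3 := hMJ u v
      omega
  · rw [tc, if_neg hr]; omega

/-- The dual multi-inversion set. -/
def dual (n : ℕ) (s : ℕ → ℕ) (I : ℕ → ℕ → ℕ) (y x : ℕ) : ℕ :=
  if 1 ≤ x ∧ x < y ∧ y ≤ n then s y - I y x else 0

theorem dual_valid {I : ℕ → ℕ → ℕ} (hI : ValidInv n s I) : ValidInv n s (dual n s I) where
  le := fun y x => by rw [dual]; split_ifs <;> omega
  out := fun y x h => by rw [dual, if_neg h]
  tr := by
    intro a b c ha hab hbc hc
    simp only [dual]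
    rw [if_pos (by omega), if_pos (by omega), if_pos (by omega)]
    have := hI.pl a b c ha hab hbc hc
    omega
  pl := by
    intro a b c ha hab hbc hc
    simp only [dual]
    rw [if_pos (by omega), if_pos (by omega), if_pos (by omega)]
    have := hI.tr a b c ha hab hbc hc
    have := hI.le c a
    have := hI.le c b
    have := hI.le b a
    omega

/-- `(a,b)` is a good pair for `T`. -/
def Good (n : ℕ) (s : ℕ → ℕ) (T : ℕ → ℕ → ℕ) (a b : ℕ) : Prop :=
  1 ≤ a ∧ a < b ∧ b ≤ n ∧ ∀ e, a < e → e < b → T e a = s e ∨ T b a < T b e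

/-- pointwise maximum of a finite family -/
noncomputable def supFam (S : Finset (ℕ → ℕ → ℕ)) (y x : ℕ) : ℕ := S.sup (fun w => w y x)

theorem supFam_ge {S : Finset (ℕ → ℕ → ℕ)} {w : ℕ → ℕ → ℕ} (h : w ∈ S) (y x : ℕ) :
    w y x ≤ supFam S y x := Finset.le_sup (f := fun w => w y x) h

theorem supFam_le {S : Finset (ℕ → ℕ → ℕ)} {y x m : ℕ} (h : ∀ w ∈ S, w y x ≤ m) :
    supFam S y x ≤ m := Finset.sup_le h

theorem supFam_pos {S : Finset (ℕ → ℕ → ℕ)} {y x : ℕ} (h : 0 < supFam S y x) :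
    ∃ w ∈ S, w y x = supFam S y x := by
  have hne : S.Nonempty := by
    rcases S.eq_empty_or_nonempty with h' | h'
    · subst h'; simp [supFam] at h
    · exact h'
  obtain ⟨w, hw, he⟩ := Finset.exists_mem_eq_sup S hne (fun w => w y x)
  exact ⟨w, hw, he.symm⟩

theorem supFam_valid {S : Finset (ℕ → ℕ → ℕ)} (hS : ∀ w ∈ S, ValidInv n s w) :
    ValidInv n s (tc n (supFam S)) := by
  apply tc_valid
  · exact fun y x => supFam_le fun w hw => (hS w hw).le y x
  · intro a b c ha hab hbc hc
    by_cases h0 : 0 < supFam S c a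
    · obtain ⟨w, hw, he⟩ := supFam_pos h0
      have h1 := supFam_ge hw c b
      have h2 := supFam_ge hw b a
      have h3 : supFam S b a ≤ s b := supFam_le fun w hw => (hS w hw).le b a
      have := (hS w hw).pl a b c ha hab hbc hc
      omega
    · right; omega

theorem join_good {S : Finset (ℕ → ℕ → ℕ)} {T : ℕ → ℕ → ℕ}
    (hS : ∀ w ∈ S, ValidInv n s w) (hTS : ∀ w ∈ S, ∀ y x, T y x ≤ w y x)
    {a b : ℕ} (hg : Good n s T a b) (heq : ∀ w ∈ S, w b a = T b a) :
    tc n (supFam S) b a ≤ T b a := by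
  obtain ⟨ha, hab, hb, hgood⟩ := hg
  refine tc_le fun d hd h => ?_
  induction h using Relation.ReflTransGen.head_induction_on with
  | refl => exact supFam_le fun w hw => (heq w hw).le
  | head hst htl ih =>
    rename_i u v
    have h1 := hst.2.1
    have h2 := Reach.le htl
    have ih' := ih (by omega)
    obtain ⟨w, hw, he⟩ := supFam_pos hst.2.2
    have h3 := supFam_ge hw b v
    have h4 := (hS w hw).tr v u b hst.1 h1 hd hb
    have h5 := hst.2.2
    have h6 := hTS w hw b u
    have h7 := (hS w hw).le u v
    have h8 := hgood u (by omega) hd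
    refine supFam_le fun w' hw' => ?_
    have h9 := (hS w' hw').tr a u b ha (by omega) hd hb
    have h10 := hTS w' hw' u a
    have h11 := heq w' hw'
    omega

theorem meet_good {w w' T : ℕ → ℕ → ℕ} (hw : ValidInv n s w) (hw' : ValidInv n s w')
    (hT : ValidInv n s T)
    (h : ∀ y x, T y x ≤ w y x) (h' : ∀ y x, T y x ≤ w' y x)
    {a b : ℕ} (hg : Good n s T a b) (hlt : T b a < w b a) (hlt' : T b a < w' b a) :
    T b a < dual n s (tc n (supFam {dual n s w, dual n s w'})) b a := by
  obtain ⟨ha, hab, hb, hgood⟩ := hg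
  have hsb := hw.le b a
  suffices hs : tc n (supFam {dual n s w, dual n s w'}) b a ≤ s b - (T b a + 1) by
    rw [dual, if_pos ⟨ha, hab, hb⟩]; omega
  refine tc_le fun d hd hr => ?_
  suffices hs : d = a ∨ T b a < T b d by
    have hda := Reach.le hr
    refine supFam_le fun u hu => ?_
    simp only [Finset.mem_insert, Finset.mem_singleton] at hu
    rcases hu with rfl | rfl
    · rw [dual, if_pos (by omega)]
      have := h b d
      rcases hs with rfl | hs <;> omega
    · rw [dual, if_pos (by omega)]
      have := h' b d
      rcases hs with rfl | hs <;> omega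
  induction hr using Relation.ReflTransGen.head_induction_on with
  | refl => exact Or.inl rfl
  | head hst htl ih =>
    rename_i u v
    have h1 := hst.2.1
    have h2 := Reach.le htl
    have ih' := ih (by omega)
    obtain ⟨z, hz, he⟩ := supFam_pos hst.2.2
    have h5 := hst.2.2
    have key : T u v < s u := by
      simp only [Finset.mem_insert, Finset.mem_singleton] at hz
      have := h u v
      have := h' u v
      rcases hz with rfl | rfl
      · rw [dual, if_pos (by omega)] at he
        omega
      · rw [dual, if_pos (by omega)] at he
        omega
    right
    rcases ih' with rfl | ih'
    · have := hgood u (by omega) hd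
      omega
    · have := hT.pl v u b hst.1 h1 hd hb
      omega

/-- every strictly larger element increases some good pair -/
theorem exists_good {T x : ℕ → ℕ → ℕ} (hT : ValidInv n s T) (hx : ValidInv n s x)
    (hle : ∀ u v, T u v ≤ x u v) (hne : ∃ u v, T u v < x u v) :
    ∃ a b, Good n s T a b ∧ T b a < x b a := by
  have hex : ∃ k a b, b - a = k ∧ T b a < x b a := by
    obtain ⟨u, v, h⟩ := hne
    exact ⟨_, v, u, rfl, h⟩
  obtain ⟨a, b, hk, hlt⟩ := Nat.find_spec hex
  have hmin := fun m => Nat.find_min hex (m := m)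
  rw [← hk] at hmin
  have hr : 1 ≤ a ∧ a < b ∧ b ≤ n := by
    by_contra hc
    rw [hx.out _ _ hc] at hlt
    omega
  refine ⟨a, b, ⟨hr.1, hr.2.1, hr.2.2, fun e hae heb => ?_⟩, hlt⟩
  have h1 : ¬ T b e < x b e := fun h => hmin (b - e) (by omega) ⟨e, b, rfl, h⟩
  have h2 : ¬ T e a < x e a := fun h => hmin (e - a) (by omega) ⟨a, e, rfl, h⟩
  have h3 := hx.pl a e b hr.1 hae heb hr.2.2
  have h4 := hle b e
  have h5 := hle e a
  omega

end InvLat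

namespace SDecTree

variable {n : ℕ} {s : ℕ → ℕ}

/-- The `s`-weak order as a partial order. -/
instance wpo : PartialOrder (SDecTree n s) where
  le := wle
  lt := wlt
  le_refl := fun T y x => le_rfl
  le_trans := fun T U V h h' y x => (h y x).trans (h' y x)
  lt_iff_le_not_ge := fun T U => Iff.rfl
  le_antisymm := fun T U h h' =>
    card_inj (funext fun y => funext fun x => le_antisymm (h y x) (h' y x))

instance wfin : Finite (SDecTree n s) := by
  refine Finite.of_injective
    (β := (y : Fin (n + 1)) → Fin (n + 1) → Fin (s y + 1))
    (fun T y x => ⟨T.card y x, Nat.lt_succ_of_le (T.card_le y x)⟩) ?_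
  intro T U h
  apply card_inj
  funext y x
  by_cases hr : 1 ≤ x ∧ x < y ∧ y ≤ n
  · have := congrFun (congrFun h ⟨y, by omega⟩) ⟨x, by omega⟩
    simpa using this
  · rw [T.card_out hr, U.card_out hr]

theorem exists_join (T : SDecTree n s) (S : Finset (SDecTree n s)) (hS : ∀ w ∈ S, T ≤ w) :
    ∃ J : SDecTree n s, (∀ x, J ≤ x ↔ ∀ w ∈ S, w ≤ x) ∧
      ∀ a b, InvLat.Good n s T.card a b → (∀ w ∈ S, w.card b a = T.card b a) →
        J.card b a ≤ T.card b a := by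
  have hv : ∀ w ∈ S.image card, ValidInv n s w := by
    intro w hw
    obtain ⟨U, -, rfl⟩ := Finset.mem_image.1 hw
    exact U.card_valid
  have hJ := InvLat.supFam_valid hv
  refine ⟨ofInv hJ, fun x => ⟨fun h w hw y z => ?_, fun h y z => ?_⟩, fun a b hg heq => ?_⟩
  · refine le_trans ?_ (h y z)
    rw [card_ofInv]
    refine le_trans (InvLat.supFam_ge (Finset.mem_image_of_mem _ hw) y z) (InvLat.le_tc ?_ y z)
    intro y' x' hr
    exact Nat.le_zero.1 (InvLat.supFam_le fun u hu => ((hv u hu).out _ _ hr).le)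
  · rw [card_ofInv]
    refine InvLat.tc_least x.card_valid (fun y' x' => InvLat.supFam_le fun u hu => ?_) y z
    obtain ⟨U, hU, rfl⟩ := Finset.mem_image.1 hu
    exact h U hU y' x'
  · rw [card_ofInv]
    refine InvLat.join_good hv ?_ hg ?_
    · intro w hw
      obtain ⟨U, hU, rfl⟩ := Finset.mem_image.1 hw
      exact hS U hU
    · intro w hw
      obtain ⟨U, hU, rfl⟩ := Finset.mem_image.1 hw
      exact heq U hU

theorem exists_meet (T U V : SDecTree n s) (hU : T ≤ U) (hV : T ≤ V) :
    ∃ m : SDecTree n s, T ≤ m ∧ m ≤ U ∧ m ≤ V ∧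
      ∀ a b, InvLat.Good n s T.card a b → T.card b a < U.card b a → T.card b a < V.card b a →
        T.card b a < m.card b a := by
  have hv : ∀ w ∈ ({InvLat.dual n s U.card, InvLat.dual n s V.card} : Finset (ℕ → ℕ → ℕ)),
      ValidInv n s w := by
    intro w hw
    simp only [Finset.mem_insert, Finset.mem_singleton] at hw
    rcases hw with rfl | rfl
    · exact InvLat.dual_valid U.card_valid
    · exact InvLat.dual_valid V.card_valid
  have hJ := InvLat.supFam_valid hv
  have hM := InvLat.dual_valid hJ
  have hout : ∀ y x, ¬ (1 ≤ x ∧ x < y ∧ y ≤ n) → InvLat.supFam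
      {InvLat.dual n s U.card, InvLat.dual n s V.card} y x = 0 := by
    intro y' x' hr
    exact Nat.le_zero.1 (InvLat.supFam_le fun u hu => ((hv u hu).out _ _ hr).le)
  have hlow : ∀ W : SDecTree n s, InvLat.dual n s W.card ∈
      ({InvLat.dual n s U.card, InvLat.dual n s V.card} : Finset (ℕ → ℕ → ℕ)) →
      ofInv hM ≤ W := by
    intro W hW y x
    rw [card_ofInv]
    by_cases hr : 1 ≤ x ∧ x < y ∧ y ≤ n
    · have h1 := (InvLat.supFam_ge hW y x).trans (InvLat.le_tc hout y x)
      have h2 := W.card_le y x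
      rw [InvLat.dual, if_pos hr] at h1 ⊢
      omega
    · rw [hM.out _ _ hr]; omega
  refine ⟨ofInv hM, fun y x => ?_, hlow U (by simp), hlow V (by simp), fun a b hg h1 h2 => ?_⟩
  · rw [card_ofInv]
    by_cases hr : 1 ≤ x ∧ x < y ∧ y ≤ n
    · have h1 := InvLat.tc_least (InvLat.dual_valid T.card_valid)
        (M := InvLat.supFam {InvLat.dual n s U.card, InvLat.dual n s V.card}) (fun y' x' =>
          InvLat.supFam_le fun u hu => ?_) y x
      · have h2 := T.card_le y x
        rw [InvLat.dual, if_pos hr] at h1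
        rw [InvLat.dual, if_pos hr]
        omega
      · have a1 := hU y' x'
        have a2 := hV y' x'
        simp only [Finset.mem_insert, Finset.mem_singleton] at hu
        rcases hu with rfl | rfl
        · simp only [InvLat.dual]; split_ifs <;> omega
        · simp only [InvLat.dual]; split_ifs <;> omega
    · rw [T.card_out hr]; omega
  · rw [card_ofInv]
    exact InvLat.meet_good U.card_valid V.card_valid T.card_valid hU hV hg h1 h2

/-- The crosscut data of an interval. -/
theorem crosscut_data (T Z : SDecTree n s) (hTZ : T ≤ Z) :
    ∃ (k : ℕ) (φ : Finset (Fin k) → SDecTree n s) (ψ : SDecTree n s → Finset (Fin k)),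
      (∀ S x, T ≤ x → (φ S ≤ x ↔ S ⊆ ψ x)) ∧ Monotone ψ ∧ (∀ S, ψ (φ S) = S) ∧
      (∀ S, T ≤ φ S) ∧ ψ Z = Finset.univ ∧ (∀ x, T < x → x ≤ Z → (ψ x).Nonempty) := by
  have : Fintype (SDecTree n s) := Fintype.ofFinite _
  obtain ⟨k, ⟨e⟩⟩ := Finite.exists_equiv_fin {x : SDecTree n s // T ⋖ x ∧ x ≤ Z}
  have hcov : ∀ i, T ⋖ (e.symm i).1 := fun i => (e.symm i).2.1
  have hex : ∀ S : Finset (Fin k), ∃ J : SDecTree n s, (∀ x, J ≤ x ↔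
      ∀ w ∈ insert T (S.image fun i => (e.symm i).1), w ≤ x) ∧
      ∀ a b, InvLat.Good n s T.card a b →
        (∀ w ∈ insert T (S.image fun i => (e.symm i).1), w.card b a = T.card b a) →
        J.card b a ≤ T.card b a := by
    intro S
    apply exists_join
    intro w hw
    simp only [Finset.mem_insert, Finset.mem_image] at hw
    rcases hw with rfl | ⟨i, -, rfl⟩
    · exact le_rfl
    · exact (hcov i).le
  choose φ hφ hφ' using hex
  have hφ1 : ∀ S x, φ S ≤ x ↔ T ≤ x ∧ ∀ i ∈ S, (e.symm i).1 ≤ x := by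
    intro S x
    rw [hφ]
    simp [Finset.forall_mem_insert, Finset.mem_image]
  refine ⟨k, φ, fun x => Finset.univ.filter fun i => (e.symm i).1 ≤ x, ?_, ?_, ?_, ?_, ?_, ?_⟩
  · intro S x hx
    rw [hφ1]
    simp [Finset.subset_iff, hx]
  · intro x y hxy i
    simp only [Finset.mem_filter, Finset.mem_univ, true_and]
    exact fun h => h.trans hxy
  · intro S
    ext i
    simp only [Finset.mem_filter, Finset.mem_univ, true_and]
    constructor
    · intro hle
      by_contra hi
      have hlt := (hcov i).lt
      obtain ⟨a, b, hg, hab⟩ := InvLat.exists_good T.card_valid (e.symm i).1.card_valid hlt.1 (by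
        by_contra hc
        push Not at hc
        exact hlt.2 hc)
      have h1 := hφ' S a b hg (by
        intro w hw
        simp only [Finset.mem_insert, Finset.mem_image] at hw
        rcases hw with rfl | ⟨j, hj, rfl⟩
        · rfl
        · by_contra hne
          have hTj : T ≤ (e.symm j).1 := (hcov j).le
          have hlt' : T.card b a < (e.symm j).1.card b a := lt_of_le_of_ne (hTj b a) (Ne.symm hne)
          obtain ⟨m, m1, m2, m3, m4⟩ := exists_meet T _ _ hlt.le hTj
          have m5 := m4 a b hg hab hlt'
          have hTm : T < m := ⟨m1, fun h => by have := h b a; omega⟩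
          have e1 : m = (e.symm i).1 := by
            by_contra hh
            exact (hcov i).2 hTm (lt_of_le_of_ne m2 hh)
          have e2 : m = (e.symm j).1 := by
            by_contra hh
            exact (hcov j).2 hTm (lt_of_le_of_ne m3 hh)
          have : i = j := e.symm.injective (Subtype.ext (e1.symm.trans e2))
          exact hi (this ▸ hj))
      have h2 := hle b a
      omega
    · intro hi
      exact ((hφ1 S _).1 le_rfl).2 i hi
  · exact fun S => ((hφ1 S _).1 le_rfl).1
  · ext i
    simp [(e.symm i).2.2]
  · intro x hTx hxZ
    obtain ⟨y, hy, hyx⟩ := exists_covBy_le_of_lt hTx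
    refine ⟨e ⟨y, hy, hyx.trans hxZ⟩, ?_⟩
    simp [hyx]

end SDecTree


/-! ### Order complexes of finite posets, the crosscut theorem and Möbius functions -/

namespace Crosscut

section Push

variable {α β γ M : Type*} [Fintype α] [Fintype β] [AddCommMonoid M]

/-- Push-forward of a weight function. -/
noncomputable def push (g : α → β) (f : α → M) (W : β) : M :=
  ∑ U ∈ Finset.univ.filter (fun U => g U = W), f U

theorem push_ne_zero {g : α → β} {f : α → M} {W : β} (h : push g f W ≠ 0) :
    ∃ U, g U = W ∧ f U ≠ 0 := by
  obtain ⟨U, hU, hne⟩ := Finset.exists_ne_zero_of_sum_ne_zero h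
  exact ⟨U, (Finset.mem_filter.1 hU).2, hne⟩

theorem sum_filter_push (g : α → β) (f : α → M) (p : β → Prop)
    [DecidablePred p] [DecidablePred fun U => p (g U)] :
    ∑ W ∈ Finset.univ.filter p, push g f W = ∑ U ∈ Finset.univ.filter (fun U => p (g U)), f U := by
  rw [← Finset.sum_fiberwise_of_maps_to (s := Finset.univ.filter (fun U => p (g U)))
    (t := Finset.univ.filter p) (g := g) (by simp)]
  refine Finset.sum_congr rfl fun W hW => ?_
  rw [push]
  refine Finset.sum_congr ?_ fun _ _ => rfl
  ext U
  simp only [Finset.mem_filter, Finset.mem_univ, true_and] at hW ⊢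
  constructor
  · rintro rfl; exact ⟨hW, rfl⟩
  · exact fun h => h.2

theorem sum_push (g : α → β) (f : α → M) : ∑ W, push g f W = ∑ U, f U := by
  have := sum_filter_push g f (fun _ => True)
  simpa using this

theorem push_push [Fintype γ] (g : α → β) (h : β → γ) (f : α → M) :
    push h (push g f) = push (h ∘ g) f := by
  funext W
  exact sum_filter_push g f (fun V => h V = W)

theorem push_id (f : α → M) : push id f = f := by
  funext W
  simp [push, Finset.sum_filter]

end Push

section Complex

variable {α : Type*} [PartialOrder α] [Fintype α]

/-- The geometric realization of the order complex of the subposet `Ω`. -/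
def OC (Ω : Set α) : Set (α → ℝ) :=
  {f | (∀ U, 0 ≤ f U) ∧ (∀ U, f U ≠ 0 → U ∈ Ω) ∧
    (∀ U V, f U ≠ 0 → f V ≠ 0 → U ≤ V ∨ V ≤ U) ∧ ∑ U, f U = 1}

theorem push_nonneg {ι κ : Type*} [Fintype ι] {g : ι → κ} {f : ι → ℝ} (h : ∀ U, 0 ≤ f U) (W : κ) :
    0 ≤ push g f W :=
  Finset.sum_nonneg fun U _ => h U

theorem mix_mem {Ω : Set α} {ι : Type*} [Fintype ι] {g h : ι → α} {p q : ι → ℝ}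
    (hp : ∀ U, 0 ≤ p U) (hq : ∀ U, 0 ≤ q U) (hsum : ∑ U, p U + ∑ U, q U = 1)
    (hpΩ : ∀ U, p U ≠ 0 → h U ∈ Ω) (hqΩ : ∀ U, q U ≠ 0 → g U ∈ Ω)
    (hpp : ∀ U V, p U ≠ 0 → p V ≠ 0 → h U ≤ h V ∨ h V ≤ h U)
    (hqq : ∀ U V, q U ≠ 0 → q V ≠ 0 → g U ≤ g V ∨ g V ≤ g U)
    (hpq : ∀ U V, p U ≠ 0 → q V ≠ 0 → g V ≤ h U) :
    (fun W => push h p W + push g q W) ∈ OC Ω := by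
  have key : ∀ W, push h p W + push g q W ≠ 0 →
      (∃ U, h U = W ∧ p U ≠ 0) ∨ (∃ U, g U = W ∧ q U ≠ 0) := by
    intro W hW
    by_cases h1 : push h p W = 0
    · right
      rw [h1, zero_add] at hW
      exact push_ne_zero hW
    · exact Or.inl (push_ne_zero h1)
  refine ⟨fun W => add_nonneg (push_nonneg hp W) (push_nonneg hq W), ?_, ?_, ?_⟩
  · intro W hW
    rcases key W hW with ⟨U, rfl, hU⟩ | ⟨U, rfl, hU⟩
    · exact hpΩ U hU
    · exact hqΩ U hU
  · intro W W' hW hW'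
    rcases key W hW with ⟨U, rfl, hU⟩ | ⟨U, rfl, hU⟩ <;>
      rcases key W' hW' with ⟨V, rfl, hV⟩ | ⟨V, rfl, hV⟩
    · exact hpp U V hU hV
    · exact Or.inr (hpq U V hU hV)
    · exact Or.inl (hpq V U hV hU)
    · exact hqq U V hU hV
  · rw [Finset.sum_add_distrib, sum_push, sum_push, hsum]

theorem push_mem {Ω : Set α} {g : α → α} (hg : Monotone g) (hΩ : ∀ U ∈ Ω, g U ∈ Ω) {f : α → ℝ}
    (hf : f ∈ OC Ω) : push g f ∈ OC Ω := by
  obtain ⟨h1, h2, h3, h4⟩ := hf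
  refine ⟨push_nonneg h1, ?_, ?_, by rw [sum_push, h4]⟩
  · intro W hW
    obtain ⟨U, rfl, hU⟩ := push_ne_zero hW
    exact hΩ U (h2 U hU)
  · intro W W' hW hW'
    obtain ⟨U, rfl, hU⟩ := push_ne_zero hW
    obtain ⟨V, rfl, hV⟩ := push_ne_zero hW'
    exact (h3 U V hU hV).imp (fun h => hg h) (fun h => hg h)

/-- The map of order complexes induced by a monotone map. -/
noncomputable def pushC {Ω : Set α} (g : α → α) (hg : Monotone g) (hΩ : ∀ U ∈ Ω, g U ∈ Ω) :
    C(OC Ω, OC Ω) where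
  toFun f := ⟨push g f.1, push_mem hg hΩ f.2⟩
  continuous_toFun := by
    refine Continuous.subtype_mk (continuous_pi fun W => ?_) _
    unfold push
    fun_prop

/-- The mass strictly above `U`. -/
noncomputable def above (f : α → ℝ) (U : α) : ℝ := ∑ V ∈ Finset.univ.filter (fun V => U < V), f V

/-- The part of the mass at `U` lying in the top `t` of the total mass. -/
noncomputable def top (t : ℝ) (f : α → ℝ) (U : α) : ℝ := min (f U) (max 0 (t - above f U))

theorem above_nonneg {f : α → ℝ} (hf : ∀ U, 0 ≤ f U) (U : α) : 0 ≤ above f U :=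
  Finset.sum_nonneg fun V _ => hf V

theorem above_lt {f : α → ℝ} (hf : ∀ U, 0 ≤ f U) {U V : α} (h : U < V) :
    above f V + f V ≤ above f U := by
  unfold above
  rw [add_comm, ← Finset.sum_insert (by simp)]
  refine Finset.sum_le_sum_of_subset_of_nonneg ?_ fun _ _ _ => hf _
  intro W
  simp only [Finset.mem_insert, Finset.mem_filter, Finset.mem_univ, true_and]
  rintro (rfl | h')
  · exact h
  · exact h.trans h'

theorem above_le {f : α → ℝ} (hf : ∀ U, 0 ≤ f U) (U : α) : above f U + f U ≤ ∑ V, f V := by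
  unfold above
  rw [add_comm, ← Finset.sum_insert (by simp)]
  exact Finset.sum_le_sum_of_subset_of_nonneg (Finset.subset_univ _) fun _ _ _ => hf _

theorem top_nonneg {f : α → ℝ} (hf : ∀ U, 0 ≤ f U) (t : ℝ) (U : α) : 0 ≤ top t f U :=
  le_min (hf U) (le_max_left _ _)

theorem top_le (t : ℝ) (f : α → ℝ) (U : α) : top t f U ≤ f U := min_le_left _ _

theorem top_zero {f : α → ℝ} (hf : ∀ U, 0 ≤ f U) (U : α) : top 0 f U = 0 := by
  have h1 := above_nonneg hf U
  rw [top, max_eq_left (by linarith), min_eq_right (hf U)]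

theorem top_one {f : α → ℝ} (hf : ∀ U, 0 ≤ f U) (hs : ∑ U, f U = 1) (U : α) : top 1 f U = f U := by
  have h1 := above_le hf U
  have h2 := hf U
  rw [top, max_eq_right (by linarith), min_eq_left (by linarith)]

theorem top_compare {f : α → ℝ} (hf : ∀ U, 0 ≤ f U) {t : ℝ} {U V : α} (hU : top t f U ≠ 0)
    (hV : f V - top t f V ≠ 0) : ¬ U < V := by
  intro hUV
  have h1 := above_lt hf hUV
  have h2 : 0 < top t f U := lt_of_le_of_ne (top_nonneg hf t U) (Ne.symm hU)
  have h3 : above f U < t := by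
    by_contra hc
    rw [top, max_eq_left (by linarith), min_eq_right (hf U)] at h2
    exact lt_irrefl _ h2
  have h4 : t - above f V < f V := by
    by_contra hc
    apply hV
    rw [top, min_eq_left, sub_self]
    exact le_max_of_le_right (by linarith)
  linarith

/-- Comparable monotone maps induce homotopic maps. -/
theorem push_homotopic {Ω : Set α} (g h : α → α) (hg : Monotone g) (hh : Monotone h)
    (gΩ : ∀ U ∈ Ω, g U ∈ Ω) (hΩ : ∀ U ∈ Ω, h U ∈ Ω) (hgh : ∀ U ∈ Ω, g U ≤ h U) :
    ContinuousMap.Homotopic (pushC g hg gΩ) (pushC h hh hΩ) := by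
  refine ⟨⟨⟨fun x => ⟨fun W => push h (top x.1.1 x.2.1) W +
      push g (fun U => x.2.1 U - top x.1.1 x.2.1 U) W, ?_⟩, ?_⟩, ?_, ?_⟩⟩
  · obtain ⟨⟨t, ht⟩, ⟨f, h1, h2, h3, h4⟩⟩ := x
    have hne : ∀ U, top t f U ≠ 0 → f U ≠ 0 := by
      intro U hU hf
      have a1 := top_le t f U
      have a2 := top_nonneg h1 t U
      exact hU (by linarith)
    have hne' : ∀ U, f U - top t f U ≠ 0 → f U ≠ 0 := by
      intro U hU hf
      have a1 := top_le t f U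
      have a2 := top_nonneg h1 t U
      exact hU (by linarith)
    refine mix_mem (top_nonneg h1 t) (fun U => sub_nonneg.2 (top_le t f U)) ?_ ?_ ?_ ?_ ?_ ?_
    · rw [Finset.sum_sub_distrib]; linarith
    · exact fun U hU => hΩ U (h2 U (hne U hU))
    · exact fun U hU => gΩ U (h2 U (hne' U hU))
    · exact fun U V hU hV => (h3 U V (hne U hU) (hne V hV)).imp (fun h => hh h) (fun h => hh h)
    · exact fun U V hU hV => (h3 U V (hne' U hU) (hne' V hV)).imp (fun h => hg h) (fun h => hg h)
    · intro U V hU hV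
      have hVU : V ≤ U := by
        rcases h3 U V (hne U hU) (hne' V hV) with h | h
        · rcases h.eq_or_lt with h | h
          · exact h.ge
          · exact absurd h (top_compare h1 hU hV)
        · exact h
      exact (hgh V (h2 V (hne' V hV))).trans (hh hVU)
  · refine Continuous.subtype_mk (continuous_pi fun W => ?_) _
    have hE : ∀ U, Continuous fun a : unitInterval × OC Ω => a.2.1 U := fun U =>
      (continuous_apply U).comp (continuous_subtype_val.comp continuous_snd)
    have hθ : ∀ U, Continuous fun a : unitInterval × OC Ω => top a.1.1 a.2.1 U := by
      intro U
      unfold top above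
      exact (hE U).min (continuous_const.max ((continuous_subtype_val.comp continuous_fst).sub
        (continuous_finsetSum _ fun V _ => hE V)))
    unfold push
    refine Continuous.add (continuous_finsetSum _ fun U _ => hθ U)
      (continuous_finsetSum _ fun U _ => Continuous.sub (hE U) (hθ U))
  · intro f
    apply Subtype.ext
    funext W
    have h1 := f.2.1
    simp [pushC, push, top_zero h1]
  · intro f
    apply Subtype.ext
    funext W
    have h1 := f.2.1
    have h4 := f.2.2.2.2
    simp [pushC, push, top_one h1 h4]

theorem pushC_id {Ω : Set α} : pushC (Ω := Ω) id monotone_id (fun _ h => h) =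
    ContinuousMap.id _ := by
  ext f
  simp [pushC, push_id]

end Complex

/-! ### The cube model of the sphere -/

section Cube

variable {m : ℕ}

/-- Vectors with minimum zero and maximum one. -/
def Cube (m : ℕ) : Set (Fin (m + 1) → ℝ) :=
  {x | (∀ i, 0 ≤ x i ∧ x i ≤ 1) ∧ (∃ i, x i = 0) ∧ ∃ i, x i = 1}

/-- lower end of a level cell -/
noncomputable def hi (x : Fin (m + 1) → ℝ) (S : Finset (Fin (m + 1))) : ℝ :=
  Finset.univ.sup' Finset.univ_nonempty (fun i => if i ∈ S then 0 else x i)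

/-- upper end of a level cell -/
noncomputable def lo (x : Fin (m + 1) → ℝ) (S : Finset (Fin (m + 1))) : ℝ :=
  Finset.univ.inf' Finset.univ_nonempty (fun i => if i ∈ S then x i else 1)

/-- weight of a level set -/
noncomputable def wt (x : Fin (m + 1) → ℝ) (S : Finset (Fin (m + 1))) : ℝ :=
  max (lo x S - hi x S) 0

theorem continuous_wt (S : Finset (Fin (m + 1))) :
    Continuous (fun x : Fin (m + 1) → ℝ => wt x S) := by
  unfold wt
  refine Continuous.max (Continuous.sub ?_ ?_) continuous_const
  · unfold lo
    refine Continuous.finset_inf'_apply Finset.univ_nonempty fun i _ => ?_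
    split_ifs <;> fun_prop
  · unfold hi
    refine Continuous.finset_sup'_apply Finset.univ_nonempty fun i _ => ?_
    split_ifs <;> fun_prop

theorem mem_cell {x : Fin (m + 1) → ℝ} (hx : ∀ i, 0 ≤ x i ∧ x i ≤ 1) {S : Finset (Fin (m + 1))}
    {t : ℝ} : t ∈ Set.Ico (hi x S) (lo x S) ↔ (0 ≤ t ∧ t < 1) ∧ ∀ i, i ∈ S ↔ t < x i := by
  rw [Set.mem_Ico, hi, lo, Finset.sup'_le_iff, Finset.lt_inf'_iff]
  constructor
  · rintro ⟨h1, h2⟩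
    refine ⟨⟨?_, ?_⟩, fun i => ?_⟩
    · have := h1 0 (Finset.mem_univ _)
      split_ifs at this
      · exact this
      · exact (hx 0).1.trans this
    · have := h2 0 (Finset.mem_univ _)
      split_ifs at this
      · exact this.trans_le (hx 0).2
      · exact this
    · have h3 := h1 i (Finset.mem_univ _)
      have h4 := h2 i (Finset.mem_univ _)
      constructor
      · intro hi
        rwa [if_pos hi] at h4
      · intro h
        by_contra hi
        rw [if_neg hi] at h3
        linarith
  · rintro ⟨⟨h1, h2⟩, h3⟩
    refine ⟨fun i _ => ?_, fun i _ => ?_⟩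
    · split_ifs with h
      · exact h1
      · exact not_lt.1 fun h' => h ((h3 i).2 h')
    · split_ifs with h
      · exact (h3 i).1 h
      · exact h2

theorem wt_nonneg (x : Fin (m + 1) → ℝ) (S : Finset (Fin (m + 1))) : 0 ≤ wt x S := le_max_right _ _

theorem wt_ne_zero {x : Fin (m + 1) → ℝ} (hx : ∀ i, 0 ≤ x i ∧ x i ≤ 1) {S : Finset (Fin (m + 1))}
    (h : wt x S ≠ 0) : ∃ t, (0 ≤ t ∧ t < 1) ∧ ∀ i, i ∈ S ↔ t < x i := by
  have : hi x S < lo x S := by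
    by_contra hc
    exact h (max_eq_right (by linarith))
  exact ⟨hi x S, (mem_cell hx).1 ⟨le_rfl, this⟩⟩

theorem sum_wt {x : Fin (m + 1) → ℝ} (hx : ∀ i, 0 ≤ x i ∧ x i ≤ 1)
    (A : Finset (Finset (Fin (m + 1)))) {r : ℝ} (hr : 0 ≤ r)
    (hA : ∀ t, (0 ≤ t ∧ t < r) ↔ (0 ≤ t ∧ t < 1) ∧ Finset.univ.filter (fun i => t < x i) ∈ A) :
    ∑ S ∈ A, wt x S = r := by
  have h1 : MeasureTheory.volume.real (⋃ S ∈ A, Set.Ico (hi x S) (lo x S)) =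
      ∑ S ∈ A, MeasureTheory.volume.real (Set.Ico (hi x S) (lo x S)) := by
    apply MeasureTheory.measureReal_biUnion_finset
    · intro S _ S' _ hne
      refine Set.disjoint_left.2 fun t ht ht' => hne ?_
      rw [mem_cell hx] at ht ht'
      ext i
      rw [ht.2, ht'.2]
    · exact fun _ _ => measurableSet_Ico
    · intro S _
      simp [Real.volume_Ico]
  have h2 : (⋃ S ∈ A, Set.Ico (hi x S) (lo x S)) = Set.Ico 0 r := by
    ext t
    simp only [Set.mem_iUnion, mem_cell hx, exists_prop]
    rw [Set.mem_Ico, hA t]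
    constructor
    · rintro ⟨S, hS, h, h'⟩
      refine ⟨h, ?_⟩
      convert hS
      ext i
      simp [h' i]
    · rintro ⟨h, h'⟩
      exact ⟨_, h', h, fun i => by simp⟩
  rw [h2, Real.volume_real_Ico] at h1
  rw [sub_zero, max_eq_left hr] at h1
  rw [h1]
  refine Finset.sum_congr rfl fun S _ => ?_
  rw [Real.volume_real_Ico, wt]

theorem sum_wt_mem {x : Fin (m + 1) → ℝ} (hx : ∀ i, 0 ≤ x i ∧ x i ≤ 1) (i : Fin (m + 1)) :
    ∑ S ∈ Finset.univ.filter (fun S => i ∈ S), wt x S = x i := by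
  refine sum_wt hx _ (hx i).1 fun t => ?_
  simp only [Finset.mem_filter, Finset.mem_univ, true_and]
  have := (hx i).2
  constructor
  · rintro ⟨h1, h2⟩; exact ⟨⟨h1, by linarith⟩, h2⟩
  · rintro ⟨⟨h1, h2⟩, h3⟩; exact ⟨h1, h3⟩

theorem sum_wt_univ {x : Fin (m + 1) → ℝ} (hx : ∀ i, 0 ≤ x i ∧ x i ≤ 1) :
    ∑ S, wt x S = 1 :=
  sum_wt hx _ zero_le_one fun t => by simp

end Cube

end Crosscut


namespace Crosscut

section Norm

variable {m : ℕ}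

/-- minimum of a vector -/
noncomputable def mn (z : Fin (m + 1) → ℝ) : ℝ := Finset.univ.inf' Finset.univ_nonempty z

/-- maximum of a vector -/
noncomputable def mx (z : Fin (m + 1) → ℝ) : ℝ := Finset.univ.sup' Finset.univ_nonempty z

theorem mn_le (z : Fin (m + 1) → ℝ) (i) : mn z ≤ z i := Finset.inf'_le _ (Finset.mem_univ i)

theorem le_mx (z : Fin (m + 1) → ℝ) (i) : z i ≤ mx z := Finset.le_sup' _ (Finset.mem_univ i)

theorem exists_mn (z : Fin (m + 1) → ℝ) : ∃ i, mn z = z i := by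
  obtain ⟨i, _, h⟩ := Finset.exists_mem_eq_inf' Finset.univ_nonempty z
  exact ⟨i, h⟩

theorem exists_mx (z : Fin (m + 1) → ℝ) : ∃ i, mx z = z i := by
  obtain ⟨i, _, h⟩ := Finset.exists_mem_eq_sup' Finset.univ_nonempty z
  exact ⟨i, h⟩

theorem continuous_mn : Continuous (mn : (Fin (m + 1) → ℝ) → ℝ) := by
  unfold mn
  exact Continuous.finset_inf'_apply Finset.univ_nonempty fun i _ => continuous_apply i

theorem continuous_mx : Continuous (mx : (Fin (m + 1) → ℝ) → ℝ) := by
  unfold mx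
  exact Continuous.finset_sup'_apply Finset.univ_nonempty fun i _ => continuous_apply i

/-- affine normalization -/
noncomputable def nrm (z : Fin (m + 1) → ℝ) (i : Fin (m + 1)) : ℝ := (z i - mn z) / (mx z - mn z)

theorem nrm_mem {z : Fin (m + 1) → ℝ} (h : mn z < mx z) : nrm z ∈ Cube m := by
  have h0 : 0 < mx z - mn z := sub_pos.2 h
  refine ⟨fun i => ⟨div_nonneg (sub_nonneg.2 (mn_le z i)) h0.le, ?_⟩, ?_, ?_⟩
  · rw [nrm, div_le_one h0]
    linarith [le_mx z i]
  · obtain ⟨i, hi⟩ := exists_mn z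
    exact ⟨i, by rw [nrm, hi]; simp⟩
  · obtain ⟨i, hi⟩ := exists_mx z
    exact ⟨i, by rw [nrm, ← hi]; exact div_self h0.ne'⟩

theorem nrm_affine {x z : Fin (m + 1) → ℝ} (hx : x ∈ Cube m) {a c : ℝ} (ha : 0 < a)
    (h : ∀ i, z i = a * x i + c) : nrm z = x := by
  obtain ⟨h1, ⟨i0, hi0⟩, ⟨i1, hi1⟩⟩ := hx
  have e1 : mn z = c := by
    apply le_antisymm
    · have := mn_le z i0
      rw [h, hi0] at this
      linarith
    · obtain ⟨i, hi⟩ := exists_mn z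
      rw [hi, h]
      have := mul_nonneg ha.le (h1 i).1
      linarith
  have e2 : mx z = a + c := by
    apply le_antisymm
    · obtain ⟨i, hi⟩ := exists_mx z
      rw [hi, h]
      have := mul_le_mul_of_nonneg_left (h1 i).2 ha.le
      linarith
    · have := le_mx z i1
      rw [h, hi1] at this
      linarith
  funext i
  rw [nrm, e1, e2, h, add_sub_cancel_right, add_sub_cancel_right, mul_div_cancel_left₀ _ (ne_of_gt ha)]

/-- differences with the zeroth coordinate -/
noncomputable def dif (x : Fin (m + 1) → ℝ) : EuclideanSpace ℝ (Fin m) :=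
  WithLp.toLp 2 (fun i => x i.succ - x 0)

theorem dif_ne {x : Fin (m + 1) → ℝ} (hx : x ∈ Cube m) : dif x ≠ 0 := by
  intro h
  obtain ⟨h1, ⟨i0, hi0⟩, ⟨i1, hi1⟩⟩ := hx
  have key : ∀ i, x i = x 0 := by
    intro i
    refine Fin.cases rfl (fun j => ?_) i
    have := congrArg (fun v : EuclideanSpace ℝ (Fin m) => v j) h
    simp [dif] at this
    linarith
  rw [key] at hi0 hi1
  linarith

/-- extend a vector by zero in the zeroth coordinate -/
noncomputable def ext0 (y : EuclideanSpace ℝ (Fin m)) : Fin (m + 1) → ℝ :=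
  Fin.cons 0 (fun i => y i)

theorem ext0_lt {y : EuclideanSpace ℝ (Fin m)} (hy : y ∈ Metric.sphere 0 1) :
    mn (ext0 y) < mx (ext0 y) := by
  by_contra hc
  have key : ∀ i, y i = 0 := by
    intro i
    have a1 := mn_le (ext0 y) i.succ
    have a2 := le_mx (ext0 y) i.succ
    have a3 := mn_le (ext0 y) 0
    have a4 := le_mx (ext0 y) 0
    simp only [ext0, Fin.cons_succ, Fin.cons_zero] at a1 a2 a3 a4 hc
    linarith
  have : y = 0 := by
    ext i
    simpa using key i
  rw [this] at hy
  simp at hy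

theorem continuous_ext0 : Continuous (ext0 : EuclideanSpace ℝ (Fin m) → _) := by
  refine continuous_pi fun i => ?_
  refine Fin.cases ?_ (fun j => ?_) i
  · simp only [ext0, Fin.cons_zero]
    exact continuous_const
  · simp only [ext0, Fin.cons_succ]
    fun_prop

/-- The cube model is homeomorphic to the sphere. -/
noncomputable def cubeHomeo (m : ℕ) :
    Cube m ≃ₜ Metric.sphere (0 : EuclideanSpace ℝ (Fin m)) 1 where
  toFun x := ⟨‖dif x.1‖⁻¹ • dif x.1, by
    have := norm_ne_zero_iff.2 (dif_ne x.2)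
    rw [mem_sphere_zero_iff_norm, norm_smul, norm_inv, norm_norm, inv_mul_cancel₀ this]⟩
  invFun y := ⟨nrm (ext0 y.1), nrm_mem (ext0_lt y.2)⟩
  left_inv x := by
    apply Subtype.ext
    have h0 : 0 < ‖dif x.1‖⁻¹ := inv_pos.2 (norm_pos_iff.2 (dif_ne x.2))
    refine nrm_affine x.2 (a := ‖dif x.1‖⁻¹) (c := - ‖dif x.1‖⁻¹ * x.1 0) h0 ?_
    intro i
    refine Fin.cases ?_ (fun j => ?_) i
    · simp [ext0]
    · simp [ext0, dif]
      ring
  right_inv y := by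
    apply Subtype.ext
    have h0 := sub_pos.2 (ext0_lt y.2)
    have e : dif (nrm (ext0 y.1)) = (mx (ext0 y.1) - mn (ext0 y.1))⁻¹ • y.1 := by
      ext i
      simp [dif, nrm, ext0]
      ring
    have hn : ‖y.1‖ = 1 := mem_sphere_zero_iff_norm.1 y.2
    have hd : ‖dif (nrm (ext0 y.1))‖ = (mx (ext0 y.1) - mn (ext0 y.1))⁻¹ := by
      rw [e, norm_smul, hn, mul_one, norm_inv, Real.norm_eq_abs, abs_of_pos h0]
    show ‖dif (nrm (ext0 y.1))‖⁻¹ • dif (nrm (ext0 y.1)) = y.1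
    rw [hd, e, smul_smul, inv_inv, mul_inv_cancel₀ h0.ne', one_smul]
  continuous_toFun := by
    have hc : Continuous fun x : Cube m => dif x.1 := by
      unfold dif
      refine (PiLp.continuous_toLp 2 _).comp (continuous_pi fun i => ?_)
      exact ((continuous_apply i.succ).comp continuous_subtype_val).sub
        ((continuous_apply 0).comp continuous_subtype_val)
    exact Continuous.subtype_mk
      ((hc.norm.inv₀ fun x => norm_ne_zero_iff.2 (dif_ne x.2)).smul hc) _
  continuous_invFun := by
    have hc : Continuous fun y : Metric.sphere (0 : EuclideanSpace ℝ (Fin m)) 1 => ext0 y.1 :=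
      continuous_ext0.comp continuous_subtype_val
    refine Continuous.subtype_mk (continuous_pi fun i => ?_) _
    unfold nrm
    refine Continuous.div ?_ ?_ fun y => (sub_pos.2 (ext0_lt y.2)).ne'
    · exact ((continuous_apply i).comp hc).sub (continuous_mn.comp hc)
    · exact (continuous_mx.comp hc).sub (continuous_mn.comp hc)

end Norm

section Main

variable {α : Type*} [PartialOrder α]

/-- Crosscut data for an interval. -/
structure CData (T Z : α) (k : ℕ) (φ : Finset (Fin k) → α) (ψ : α → Finset (Fin k)) : Prop where
  gc : ∀ S x, T ≤ x → (φ S ≤ x ↔ S ⊆ ψ x)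
  mono : Monotone ψ
  sec : ∀ S, ψ (φ S) = S
  le : ∀ S, T ≤ φ S
  top : ψ Z = Finset.univ
  ne : ∀ x, T < x → x ≤ Z → (ψ x).Nonempty

namespace CData

variable {T Z : α} {k : ℕ} {φ : Finset (Fin k) → α} {ψ : α → Finset (Fin k)}

theorem mono' (D : CData T Z k φ ψ) : Monotone φ := by
  intro S S' h
  rw [D.gc S _ (D.le S'), D.sec]
  exact h

theorem phi_empty (D : CData T Z k φ ψ) : φ ∅ = T :=
  le_antisymm ((D.gc _ _ le_rfl).2 (Finset.empty_subset _)) (D.le _)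

theorem psi_bot (D : CData T Z k φ ψ) : ψ T = ∅ := by
  rw [← D.phi_empty, D.sec]

theorem phipsi_le (D : CData T Z k φ ψ) {U : α} (h : T ≤ U) : φ (ψ U) ≤ U :=
  (D.gc _ _ h).2 (Finset.Subset.refl _)

theorem lt_phi (D : CData T Z k φ ψ) {S : Finset (Fin k)} (h : S.Nonempty) : T < φ S := by
  refine lt_of_le_of_ne (D.le S) fun he => h.ne_empty ?_
  rw [← D.sec S, ← he, D.psi_bot]

theorem phi_univ_le (D : CData T Z k φ ψ) (h : T ≤ Z) : φ Finset.univ ≤ Z :=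
  (D.gc _ _ h).2 D.top.ge

theorem phipsi_mem (D : CData T Z k φ ψ) {U : α} (h : U ∈ Set.Ioo T Z) :
    (φ ∘ ψ) U ∈ Set.Ioo T Z :=
  ⟨D.lt_phi (D.ne U h.1 h.2.le), (D.phipsi_le h.1.le).trans_lt h.2⟩

variable [Fintype α]

theorem contractible (D : CData T Z k φ ψ) (hTZ : T < Z) (hJ : φ Finset.univ < Z) :
    ContractibleSpace (OC (Set.Ioo T Z)) := by
  have hJm : φ Finset.univ ∈ Set.Ioo T Z := by
    refine ⟨D.lt_phi ?_, hJ⟩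
    rw [← D.top]
    exact D.ne Z hTZ le_rfl
  rw [contractible_iff_id_nullhomotopic]
  refine ⟨⟨fun U => if U = φ Finset.univ then 1 else 0, ?_, ?_, ?_, ?_⟩, ?_⟩
  · intro U; dsimp only; split_ifs <;> norm_num
  · intro U hU
    by_cases h : U = φ Finset.univ
    · rwa [h]
    · simp [h] at hU
  · intro U V hU hV
    by_cases h : U = φ Finset.univ
    · by_cases h' : V = φ Finset.univ
      · left; rw [h, h']
      · simp [h'] at hV
    · simp [h] at hU
  · simp
  · have a1 := push_homotopic (Ω := Set.Ioo T Z) (φ ∘ ψ) id (D.mono'.comp D.mono) monotone_id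
      (fun U h => D.phipsi_mem h) (fun _ h => h) (fun U h => D.phipsi_le h.1.le)
    have a2 := push_homotopic (Ω := Set.Ioo T Z) (φ ∘ ψ) (fun _ => φ Finset.univ)
      (D.mono'.comp D.mono) monotone_const
      (fun U h => D.phipsi_mem h) (fun _ _ => hJm) (fun U h => D.mono' (Finset.subset_univ _))
    rw [pushC_id] at a1
    convert a1.symm.trans a2 using 1
    ext f W
    have h4 := f.2.2.2.2
    simp only [pushC, push, ContinuousMap.const_apply, ContinuousMap.coe_mk]
    by_cases h : W = φ Finset.univ
    · rw [if_pos h]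
      simp [h, h4]
    · rw [if_neg h, Finset.filter_false_of_mem (fun _ _ h' => h h'.symm)]
      simp

theorem mobius (D : CData T Z k φ ψ) (hTZ : T ≤ Z) (μ : α → ℤ) (h1 : μ T = 1)
    (h2 : ∀ V, T < V → ∑ W ∈ Finset.univ.filter (fun W => T ≤ W ∧ W ≤ V), μ W = 0) :
    μ Z = -1 ∨ μ Z = 0 ∨ μ Z = 1 := by
  have key : ∀ V, T ≤ V → V ≤ Z → μ V = push φ (fun S => (-1 : ℤ) ^ S.card) V := by
    intro V
    induction V using WellFoundedLT.induction with
    | ind V ih =>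
    intro hV hVZ
    rcases hV.eq_or_lt with rfl | hlt
    · rw [h1, push]
      have : Finset.univ.filter (fun S => φ S = T) = {∅} := by
        ext S
        simp only [Finset.mem_filter, Finset.mem_univ, true_and, Finset.mem_singleton]
        constructor
        · intro h
          rw [← D.sec S, h, D.psi_bot]
        · rintro rfl; exact D.phi_empty
      rw [this]
      simp
    · have e1 := h2 V hlt
      have e2 : ∑ W ∈ Finset.univ.filter (fun W => T ≤ W ∧ W ≤ V),
          push φ (fun S => (-1 : ℤ) ^ S.card) W = 0 := by
        rw [sum_filter_push]
        have : Finset.univ.filter (fun S => T ≤ φ S ∧ φ S ≤ V) = (ψ V).powerset := by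
          ext S
          simp [D.le S, D.gc S V hV]
        rw [this]
        exact Finset.sum_powerset_neg_one_pow_card_of_nonempty (D.ne V hlt hVZ)
      have hmem : V ∈ Finset.univ.filter (fun W => T ≤ W ∧ W ≤ V) := by simp [hV]
      rw [← Finset.add_sum_erase _ _ hmem] at e1 e2
      have e3 : ∑ W ∈ (Finset.univ.filter (fun W => T ≤ W ∧ W ≤ V)).erase V, μ W =
          ∑ W ∈ (Finset.univ.filter (fun W => T ≤ W ∧ W ≤ V)).erase V,
            push φ (fun S => (-1 : ℤ) ^ S.card) W := by
        refine Finset.sum_congr rfl fun W hW => ?_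
        simp only [Finset.mem_erase, Finset.mem_filter, Finset.mem_univ, true_and] at hW
        exact ih W (lt_of_le_of_ne hW.2.2 hW.1) hW.2.1 (hW.2.2.trans hVZ)
      rw [e3] at e1
      linarith
  rw [key Z hTZ le_rfl, push]
  have hsub : Finset.univ.filter (fun S => φ S = Z) ⊆ {Finset.univ} := by
    intro S hS
    simp only [Finset.mem_filter, Finset.mem_univ, true_and] at hS
    rw [Finset.mem_singleton, ← D.sec S, hS, D.top]
  rcases Finset.subset_singleton_iff.1 hsub with h | h
  · rw [h]; simp
  · rw [h, Finset.sum_singleton]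
    rcases neg_one_pow_eq_or ℤ (Finset.univ : Finset (Fin k)).card with h | h
    · exact Or.inr (Or.inr h)
    · exact Or.inl h

end CData

/-- the coordinates of a point of the order complex -/
noncomputable def coord {m : ℕ} (ψ : α → Finset (Fin (m + 1))) [Fintype α] (f : α → ℝ)
    (i : Fin (m + 1)) : ℝ :=
  ∑ U ∈ Finset.univ.filter (fun U => i ∈ ψ U), f U

namespace CData

variable [Fintype α] {T Z : α} {m : ℕ} {φ : Finset (Fin (m + 1)) → α}
  {ψ : α → Finset (Fin (m + 1))}

theorem coord_mem (D : CData T Z (m + 1) φ ψ) (hTZ : T < Z) (hZ : φ Finset.univ = Z) {f : α → ℝ}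
    (hf : f ∈ OC (Set.Ioo T Z)) : coord ψ f ∈ Cube m := by
  obtain ⟨h1, h2, h3, h4⟩ := hf
  have hne : (Finset.univ.filter (fun U => f U ≠ 0)).Nonempty := by
    by_contra hc
    rw [Finset.not_nonempty_iff_eq_empty, Finset.filter_eq_empty_iff] at hc
    rw [Finset.sum_eq_zero (fun U hU => not_not.1 (hc hU))] at h4
    exact zero_ne_one h4
  refine ⟨fun i => ⟨Finset.sum_nonneg fun U _ => h1 U, ?_⟩, ?_, ?_⟩
  · rw [← h4]
    exact Finset.sum_le_sum_of_subset_of_nonneg (Finset.subset_univ _) fun _ _ _ => h1 _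
  · obtain ⟨U, hU⟩ := Finset.exists_maximal hne
    have hU0 : f U ≠ 0 := (Finset.mem_filter.1 hU.1).2
    have hUm := h2 U hU0
    have hU' : ∀ V, f V ≠ 0 → V ≤ U := by
      intro V hV
      rcases h3 U V hU0 hV with h | h
      · exact hU.2 (by simpa using hV) h
      · exact h
    have hex : ∃ i, i ∉ ψ U := by
      by_contra hc
      push Not at hc
      have : φ Finset.univ ≤ U := (D.gc _ _ hUm.1.le).2 (fun i _ => hc i)
      rw [hZ] at this
      exact absurd hUm.2 this.not_gt
    obtain ⟨i, hi⟩ := hex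
    refine ⟨i, Finset.sum_eq_zero fun V hV => ?_⟩
    by_contra hc
    exact hi (D.mono (hU' V hc) (Finset.mem_filter.1 hV).2)
  · obtain ⟨U, hU⟩ := Finset.exists_minimal hne
    have hU0 : f U ≠ 0 := (Finset.mem_filter.1 hU.1).2
    have hUm := h2 U hU0
    have hU' : ∀ V, f V ≠ 0 → U ≤ V := by
      intro V hV
      rcases h3 U V hU0 hV with h | h
      · exact h
      · exact hU.2 (by simpa using hV) h
    obtain ⟨i, hi⟩ := D.ne U hUm.1 hUm.2.le
    refine ⟨i, ?_⟩
    rw [← h4, coord]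
    refine Finset.sum_subset (Finset.subset_univ _) fun V _ hV => ?_
    by_contra hc
    exact hV (Finset.mem_filter.2 ⟨Finset.mem_univ _, D.mono (hU' V hc) hi⟩)

theorem wt_coord (D : CData T Z (m + 1) φ ψ) (hTZ : T < Z) (hZ : φ Finset.univ = Z) {f : α → ℝ}
    (hf : f ∈ OC (Set.Ioo T Z)) : wt (coord ψ f) = push ψ f := by
  have hc := D.coord_mem hTZ hZ hf
  obtain ⟨h1, h2, h3, h4⟩ := hf
  have hle : ∀ S, push ψ f S ≤ wt (coord ψ f) S := by
    intro S
    by_cases h0 : push ψ f S = 0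
    · rw [h0]; exact wt_nonneg _ _
    obtain ⟨U, hU, hfU⟩ := push_ne_zero h0
    have hcmp : ∀ V, f V ≠ 0 → ψ V ⊆ S ∨ S ⊆ ψ V := by
      intro V hV
      rw [← hU]
      exact (h3 V U hV hfU).imp (fun h => D.mono h) (fun h => D.mono h)
    refine le_max_of_le_left ?_
    obtain ⟨i, _, hi⟩ := Finset.exists_mem_eq_inf' Finset.univ_nonempty
      (fun i => if i ∈ S then coord ψ f i else 1)
    obtain ⟨j, _, hj⟩ := Finset.exists_mem_eq_sup' Finset.univ_nonempty
      (fun i => if i ∈ S then 0 else coord ψ f i)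
    rw [lo, Crosscut.hi, hi, hj, le_sub_iff_add_le]
    have e1 : (if i ∈ S then coord ψ f i else 1) =
        ∑ V, (if i ∈ S → i ∈ ψ V then f V else 0) := by
      split_ifs with h
      · simp [coord, Finset.sum_filter, h]
      · simp [h, h4]
    have e2 : (if j ∈ S then 0 else coord ψ f j) =
        ∑ V, (if j ∉ S ∧ j ∈ ψ V then f V else 0) := by
      split_ifs with h
      · simp [h]
      · simp [coord, Finset.sum_filter, h]
    rw [e1, e2, push, Finset.sum_filter, ← Finset.sum_add_distrib]
    refine Finset.sum_le_sum fun V _ => ?_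
    by_cases hV : f V = 0
    · simp [hV]
    have hV0 := h1 V
    rcases hcmp V hV with h | h
    · by_cases hj' : j ∉ S ∧ j ∈ ψ V
      · exact absurd (h hj'.2) hj'.1
      · rw [if_neg hj', add_zero]
        by_cases hS : ψ V = S
        · rw [if_pos hS, if_pos (fun h' => by rw [hS]; exact h')]
        · rw [if_neg hS]
          split_ifs <;> simp [hV0]
    · rw [if_pos (fun h' => h h')]
      by_cases hS : ψ V = S
      · rw [if_pos hS, if_neg, add_zero]
        rw [hS]
        tauto
      · rw [if_neg hS, zero_add]
        split_ifs <;> simp [hV0]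
  have hs : ∑ S, push ψ f S = ∑ S, wt (coord ψ f) S := by
    rw [sum_push, sum_wt_univ hc.1, h4]
  funext S
  exact ((Finset.sum_eq_sum_iff_of_le fun S _ => hle S).1 hs S (Finset.mem_univ _)).symm

theorem push_wt_mem (D : CData T Z (m + 1) φ ψ) (hZ : φ Finset.univ = Z) {x : Fin (m + 1) → ℝ}
    (hx : x ∈ Cube m) : push φ (wt x) ∈ OC (Set.Ioo T Z) := by
  obtain ⟨h1, ⟨i0, hi0⟩, ⟨i1, hi1⟩⟩ := hx
  refine ⟨push_nonneg (wt_nonneg x), ?_, ?_, by rw [sum_push, sum_wt_univ h1]⟩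
  · intro W hW
    obtain ⟨S, rfl, hS⟩ := push_ne_zero hW
    obtain ⟨t, ⟨ht0, ht1⟩, ht⟩ := wt_ne_zero h1 hS
    refine ⟨D.lt_phi ⟨i1, (ht i1).2 (by rw [hi1]; exact ht1)⟩, ?_⟩
    rw [← hZ]
    refine lt_of_le_of_ne (D.mono' (Finset.subset_univ _)) fun he => ?_
    have : S = Finset.univ := by rw [← D.sec S, he, D.sec]
    have h' := (ht i0).1 (by rw [this]; simp)
    rw [hi0] at h'
    linarith
  · intro W W' hW hW'
    obtain ⟨S, rfl, hS⟩ := push_ne_zero hW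
    obtain ⟨S', rfl, hS'⟩ := push_ne_zero hW'
    obtain ⟨t, _, ht⟩ := wt_ne_zero h1 hS
    obtain ⟨t', _, ht'⟩ := wt_ne_zero h1 hS'
    rcases le_total t t' with h | h
    · right
      refine D.mono' fun i hi => ?_
      rw [ht]
      exact h.trans_lt ((ht' i).1 hi)
    · left
      refine D.mono' fun i hi => ?_
      rw [ht']
      exact h.trans_lt ((ht i).1 hi)

theorem sphere (D : CData T Z (m + 1) φ ψ) (hTZ : T < Z) (hZ : φ Finset.univ = Z) :
    Nonempty (ContinuousMap.HomotopyEquiv (OC (Set.Ioo T Z)) (Cube m)) := by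
  refine ⟨⟨⟨fun f => ⟨coord ψ f.1, D.coord_mem hTZ hZ f.2⟩, ?_⟩,
    ⟨fun x => ⟨push φ (wt x.1), D.push_wt_mem hZ x.2⟩, ?_⟩, ?_, ?_⟩⟩
  · refine Continuous.subtype_mk (continuous_pi fun i => ?_) _
    unfold coord
    fun_prop
  · refine Continuous.subtype_mk (continuous_pi fun W => ?_) _
    unfold push
    exact continuous_finsetSum _ fun S _ => (continuous_wt S).comp continuous_subtype_val
  · have a1 := push_homotopic (Ω := Set.Ioo T Z) (φ ∘ ψ) id (D.mono'.comp D.mono) monotone_id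
      (fun U h => D.phipsi_mem h) (fun _ h => h) (fun U h => D.phipsi_le h.1.le)
    rw [pushC_id] at a1
    convert a1 using 1
    ext f : 1
    apply Subtype.ext
    simp only [ContinuousMap.comp_apply, ContinuousMap.coe_mk, pushC]
    rw [D.wt_coord hTZ hZ f.2, push_push]
  · convert ContinuousMap.Homotopic.refl _ using 1
    ext x : 1
    apply Subtype.ext
    simp only [ContinuousMap.comp_apply, ContinuousMap.coe_mk, ContinuousMap.id_apply]
    funext i
    rw [coord, sum_filter_push, ← sum_wt_mem x.2.1 i]
    simp only [D.sec]

end CData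

end Main

end Crosscut

namespace SDecTree

variable {n : ℕ} {s : ℕ → ℕ}

theorem orderComplex_eq [Fintype (SDecTree n s)] (T Z : SDecTree n s) :
    orderComplex T Z = Crosscut.OC (Set.Ioo T Z) := by
  ext f
  constructor
  · rintro ⟨h1, _, h3, h4, h5⟩
    refine ⟨h1, fun U hU => h3 hU, fun U V hU hV => ?_, ?_⟩
    · by_cases h : U = V
      · exact Or.inl h.le
      · rcases h4 hU hV h with h' | h'
        · exact Or.inl (show U < V from h').le
        · exact Or.inr (show V < U from h').le
    · rwa [finsum_eq_sum_of_fintype] at h5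
  · rintro ⟨h1, h2, h3, h4⟩
    refine ⟨h1, Set.toFinite _, fun U hU => h2 U hU, fun U hU V hV hne => ?_, ?_⟩
    · rcases h3 U V hU hV with h | h
      · exact Or.inl (show U < V from lt_of_le_of_ne h hne)
      · exact Or.inr (show V < U from lt_of_le_of_ne h hne.symm)
    · rwa [finsum_eq_sum_of_fintype]

end SDecTree

/-- every open interval `(T,Z)` of the `s`-weak order has order complex
homotopy equivalent to a ball or to a sphere of some dimension, and the Möbius function
of the `s`-weak order takes only the values `-1`, `0`, `1`. -/
theorem homotopy_type_and_mobius (n : ℕ) (s : ℕ → ℕ) (T Z : SDecTree n s)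
    (hle : SDecTree.wle T Z) :
    ((∃ d : ℕ, Nonempty (ContinuousMap.HomotopyEquiv
        ↥(SDecTree.orderComplex T Z)
        ↥(Metric.closedBall (0 : EuclideanSpace ℝ (Fin d)) 1))) ∨
     (∃ d : ℕ, Nonempty (ContinuousMap.HomotopyEquiv
        ↥(SDecTree.orderComplex T Z)
        ↥(Metric.sphere (0 : EuclideanSpace ℝ (Fin d)) 1)))) ∧
    (∀ μ : SDecTree n s → SDecTree n s → ℤ,
      (∀ U, μ U U = 1) →
      (∀ U V : SDecTree n s, SDecTree.wlt U V →
        (∑ᶠ W ∈ {W : SDecTree n s | SDecTree.wle U W ∧ SDecTree.wle W V}, μ U W) = 0) →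
      μ T Z = -1 ∨ μ T Z = 0 ∨ μ T Z = 1) := by
  have hTZ : T ≤ Z := hle
  haveI : Fintype (SDecTree n s) := Fintype.ofFinite _
  obtain ⟨k, φ, ψ, h1, h2, h3, h4, h5, h6⟩ := SDecTree.crosscut_data T Z hTZ
  have D : Crosscut.CData T Z k φ ψ := ⟨h1, h2, h3, h4, h5, h6⟩
  refine ⟨?_, fun μ hμ1 hμ2 => ?_⟩
  · rw [SDecTree.orderComplex_eq]
    rcases hTZ.eq_or_lt with rfl | hlt
    · right
      refine ⟨0, ?_⟩
      haveI : IsEmpty (Crosscut.OC (Set.Ioo T T)) := by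
        refine ⟨fun f => ?_⟩
        have h4 := f.2.2.2.2
        rw [Finset.sum_eq_zero] at h4
        · exact zero_ne_one h4
        · intro U _
          by_contra hc
          have := f.2.2.1 U hc
          simp at this
      haveI : IsEmpty (Metric.sphere (0 : EuclideanSpace ℝ (Fin 0)) 1) := by
        refine ⟨fun y => ?_⟩
        have hy := mem_sphere_zero_iff_norm.1 y.2
        rw [Subsingleton.elim y.1 0, norm_zero] at hy
        exact zero_ne_one hy
      exact ⟨(Homeomorph.empty).toHomotopyEquiv⟩
    · rcases (D.phi_univ_le hTZ).eq_or_lt with hJ | hJ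
      · right
        obtain ⟨i, _⟩ := D.ne Z hlt le_rfl
        obtain ⟨m, rfl⟩ : ∃ m, k = m + 1 := ⟨k - 1, by have := i.2; omega⟩
        obtain ⟨e⟩ := D.sphere hlt hJ
        exact ⟨m, ⟨e.trans (Crosscut.cubeHomeo m).toHomotopyEquiv⟩⟩
      · left
        haveI := D.contractible hlt hJ
        haveI : ContractibleSpace (Metric.closedBall (0 : EuclideanSpace ℝ (Fin 0)) 1) :=
          (convex_closedBall _ _).contractibleSpace ⟨0, by simp⟩
        exact ⟨0, ContractibleSpace.hequiv _ _⟩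
  · refine D.mobius hTZ (μ T) (hμ1 T) fun V hV => ?_
    rw [← hμ2 T V hV]
    symm
    refine (finsum_mem_congr (Set.ext fun W => ?_) fun _ _ => rfl).trans
      (finsum_mem_coe_finset _ _)
    simp only [Finset.coe_filter, Finset.mem_univ, true_and]
    rfl
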